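/- Let d ≥ 3 be an integer. For a general pencil of plane curves of degree d over ℂ and a general line H ⊂ ℙ², the number of points p ∈ H for which there exist a member C of the pencil and a line L such that L is bitangent to C and p is one of the two tangency points of L with C is exactly (d − 3)(2d² + 5d − 6). -/

import Mathlib

noncomputable section

/-- The restriction of the form `F` to the line through `[v]` and `[w]`,
parametrized by `t ↦ v + t • w`, as a polynomial in `t`. -/
def linePoly (F : MvPolynomial (Fin 3) ℂ) (v w : Fin 3 → ℂ) : Polynomial ℂ :=
  MvPolynomial.aeval (fun i => Polynomial.C (v i) + Polynomial.X * Polynomial.C (w i)) F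

/-- The line through the two (projectively distinct) points `[v]`, `[w]` has contact
order at least `m` with the curve `{F = 0}` at the point `[v]`. -/
def ContactLE (F : MvPolynomial (Fin 3) ℂ) (v w : Fin 3 → ℂ) (m : ℕ) : Prop :=
  (Polynomial.X : Polynomial ℂ) ^ m ∣ linePoly F v w

/-- The member of the pencil spanned by `F` and `G` corresponding to `c ∈ ℙ¹`. -/
def pencilMember (F G : MvPolynomial (Fin 3) ℂ) (c : Projectivization ℂ (Fin 2 → ℂ)) :
    MvPolynomial (Fin 3) ℂ :=
  c.rep 0 • F + c.rep 1 • G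

/-- The coefficient vector of a pair of forms. -/
def coeffs2 (F G : MvPolynomial (Fin 3) ℂ) : (Fin 3 →₀ ℕ) ⊕ (Fin 3 →₀ ℕ) → ℂ :=
  Sum.elim (fun m => MvPolynomial.coeff m F) (fun m => MvPolynomial.coeff m G)

/-- The set of points `p = [v]` of `ℙ²` lying on the line `{h·y = 0}` which are a
tangency point of a bitangent line of some member of the pencil spanned by `F` and `G`:
there are a member `C` and a second point `[w]`, distinct from `[v]`, such that the line
through `[v]` and `[w]` is tangent to `C` at both `[v]` and `[w]`. -/
def bitangencyPointsOnLine (F G : MvPolynomial (Fin 3) ℂ) (h : Fin 3 → ℂ) :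
    Set (Projectivization ℂ (Fin 3 → ℂ)) :=
  {p | (∑ i, h i * p.rep i) = 0 ∧
    ∃ (c : Projectivization ℂ (Fin 2 → ℂ)) (w : Fin 3 → ℂ),
      LinearIndependent ℂ ![p.rep, w] ∧
      ContactLE (pencilMember F G c) p.rep w 2 ∧ ContactLE (pencilMember F G c) w p.rep 2}

section

open Polynomial

/-! ## Polynomial functions -/

/-- polynomial functions -/
def PF {I : Type*} (f : (I → ℂ) → ℂ) : Prop :=
  ∃ P : MvPolynomial I ℂ, ∀ x, f x = MvPolynomial.eval x P

/-- families of univariate polynomials depending polynomially on parameters -/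
def PP {I : Type*} (f : (I → ℂ) → ℂ[X]) : Prop :=
  ∃ P : (MvPolynomial I ℂ)[X], ∀ x, f x = P.map (MvPolynomial.eval x)

/-- families of ternary forms depending polynomially on parameters -/
def PM {I : Type*} (f : (I → ℂ) → MvPolynomial (Fin 3) ℂ) : Prop :=
  ∃ P : MvPolynomial (Fin 3) (MvPolynomial I ℂ), ∀ x,
    f x = MvPolynomial.map (MvPolynomial.eval x) P

section PFsec
variable {I : Type*}

lemma PF.const (a : ℂ) : PF (fun _ : I → ℂ => a) := ⟨MvPolynomial.C a, fun x => by simp⟩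
lemma PF.var (i : I) : PF (fun x : I → ℂ => x i) := ⟨MvPolynomial.X i, fun x => by simp⟩
lemma PF.add {f g : (I → ℂ) → ℂ} (hf : PF f) (hg : PF g) : PF (fun x => f x + g x) := by
  obtain ⟨P, hP⟩ := hf
  obtain ⟨Q, hQ⟩ := hg
  exact ⟨P + Q, fun x => by simp [hP, hQ]⟩
lemma PF.mul {f g : (I → ℂ) → ℂ} (hf : PF f) (hg : PF g) : PF (fun x => f x * g x) := by
  obtain ⟨P, hP⟩ := hf
  obtain ⟨Q, hQ⟩ := hg
  exact ⟨P * Q, fun x => by simp [hP, hQ]⟩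
lemma PF.neg {f : (I → ℂ) → ℂ} (hf : PF f) : PF (fun x => - f x) := by
  obtain ⟨P, hP⟩ := hf
  exact ⟨- P, fun x => by simp [hP]⟩
lemma PF.sub {f g : (I → ℂ) → ℂ} (hf : PF f) (hg : PF g) : PF (fun x => f x - g x) := by
  obtain ⟨P, hP⟩ := hf
  obtain ⟨Q, hQ⟩ := hg
  exact ⟨P - Q, fun x => by simp [hP, hQ]⟩
lemma PF.pow {f : (I → ℂ) → ℂ} (hf : PF f) (n : ℕ) : PF (fun x => f x ^ n) := by
  obtain ⟨P, hP⟩ := hf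
  exact ⟨P ^ n, fun x => by simp [hP]⟩
lemma PF.sum {ι : Type*} (s : Finset ι) {f : ι → (I → ℂ) → ℂ} (hf : ∀ i ∈ s, PF (f i)) :
    PF (fun x => ∑ i ∈ s, f i x) := by
  classical
  choose! P hP using hf
  exact ⟨∑ i ∈ s, P i, fun x => by
    rw [map_sum]; exact Finset.sum_congr rfl fun i hi => hP i hi x⟩
lemma PF.prod {ι : Type*} (s : Finset ι) {f : ι → (I → ℂ) → ℂ} (hf : ∀ i ∈ s, PF (f i)) :
    PF (fun x => ∏ i ∈ s, f i x) := by
  classical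
  choose! P hP using hf
  exact ⟨∏ i ∈ s, P i, fun x => by
    rw [map_prod]; exact Finset.prod_congr rfl fun i hi => hP i hi x⟩
lemma PF.ite {f g : (I → ℂ) → ℂ} (c : Prop) [Decidable c] (hf : PF f) (hg : PF g) :
    PF (fun x => if c then f x else g x) := by
  split_ifs
  exacts [hf, hg]
lemma PF.comp {I' : Type*} {f : (I → ℂ) → ℂ} (hf : PF f) {g : I → (I' → ℂ) → ℂ}
    (hg : ∀ i, PF (g i)) : PF (fun x => f (fun i => g i x)) := by
  obtain ⟨P, hP⟩ := hf
  choose Q hQ using hg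
  refine ⟨MvPolynomial.bind₁ Q P, fun x => ?_⟩
  simp only [hP, hQ]
  exact (MvPolynomial.eval₂Hom_bind₁ (RingHom.id ℂ) x Q P).symm

lemma PP.C {f : (I → ℂ) → ℂ} (hf : PF f) : PP (fun x => C (f x)) := by
  obtain ⟨P, hP⟩ := hf
  exact ⟨Polynomial.C P, fun x => by simp [hP]⟩
lemma PP.const (p : ℂ[X]) : PP (fun _ : I → ℂ => p) :=
  ⟨p.map MvPolynomial.C, fun x => by
    rw [Polynomial.map_map]
    ext n
    simp⟩
lemma PP.add {f g : (I → ℂ) → ℂ[X]} (hf : PP f) (hg : PP g) : PP (fun x => f x + g x) := by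
  obtain ⟨P, hP⟩ := hf
  obtain ⟨Q, hQ⟩ := hg
  exact ⟨P + Q, fun x => by simp [hP, hQ]⟩
lemma PP.mul {f g : (I → ℂ) → ℂ[X]} (hf : PP f) (hg : PP g) : PP (fun x => f x * g x) := by
  obtain ⟨P, hP⟩ := hf
  obtain ⟨Q, hQ⟩ := hg
  exact ⟨P * Q, fun x => by simp [hP, hQ]⟩
lemma PP.sub {f g : (I → ℂ) → ℂ[X]} (hf : PP f) (hg : PP g) : PP (fun x => f x - g x) := by
  obtain ⟨P, hP⟩ := hf
  obtain ⟨Q, hQ⟩ := hg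
  exact ⟨P - Q, fun x => by simp [hP, hQ]⟩
lemma PP.pow {f : (I → ℂ) → ℂ[X]} (hf : PP f) (n : ℕ) : PP (fun x => f x ^ n) := by
  obtain ⟨P, hP⟩ := hf
  exact ⟨P ^ n, fun x => by simp [hP]⟩
lemma PP.sum {ι : Type*} (s : Finset ι) {f : ι → (I → ℂ) → ℂ[X]} (hf : ∀ i ∈ s, PP (f i)) :
    PP (fun x => ∑ i ∈ s, f i x) := by
  classical
  choose! P hP using hf
  exact ⟨∑ i ∈ s, P i, fun x => by
    rw [Polynomial.map_sum]; exact Finset.sum_congr rfl fun i hi => hP i hi x⟩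
lemma PP.prod {ι : Type*} (s : Finset ι) {f : ι → (I → ℂ) → ℂ[X]} (hf : ∀ i ∈ s, PP (f i)) :
    PP (fun x => ∏ i ∈ s, f i x) := by
  classical
  choose! P hP using hf
  exact ⟨∏ i ∈ s, P i, fun x => by
    rw [Polynomial.map_prod]; exact Finset.prod_congr rfl fun i hi => hP i hi x⟩
lemma PP.coeff {f : (I → ℂ) → ℂ[X]} (hf : PP f) (n : ℕ) : PF (fun x => (f x).coeff n) := by
  obtain ⟨P, hP⟩ := hf
  exact ⟨P.coeff n, fun x => by simp [hP]⟩
lemma PP.derivative {f : (I → ℂ) → ℂ[X]} (hf : PP f) : PP (fun x => derivative (f x)) := by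
  obtain ⟨P, hP⟩ := hf
  exact ⟨Polynomial.derivative P, fun x => by simp [hP, Polynomial.derivative_map]⟩
lemma PP.resultant {f g : (I → ℂ) → ℂ[X]} (hf : PP f) (hg : PP g) (m n : ℕ) :
    PF (fun x => resultant (f x) (g x) m n) := by
  obtain ⟨P, hP⟩ := hf
  obtain ⟨Q, hQ⟩ := hg
  exact ⟨Polynomial.resultant P Q m n, fun x => by
    show Polynomial.resultant (f x) (g x) m n = _
    rw [hP, hQ, resultant_map_map]⟩

lemma PM.C {f : (I → ℂ) → ℂ} (hf : PF f) : PM (fun x => MvPolynomial.C (f x)) := by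
  obtain ⟨P, hP⟩ := hf
  exact ⟨MvPolynomial.C P, fun x => by simp [hP]⟩
lemma PM.X (i : Fin 3) : PM (fun _ : I → ℂ => MvPolynomial.X i) :=
  ⟨MvPolynomial.X i, fun x => by simp⟩
lemma PM.add {f g : (I → ℂ) → MvPolynomial (Fin 3) ℂ} (hf : PM f) (hg : PM g) :
    PM (fun x => f x + g x) := by
  obtain ⟨P, hP⟩ := hf
  obtain ⟨Q, hQ⟩ := hg
  exact ⟨P + Q, fun x => by simp [hP, hQ]⟩
lemma PM.mul {f g : (I → ℂ) → MvPolynomial (Fin 3) ℂ} (hf : PM f) (hg : PM g) :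
    PM (fun x => f x * g x) := by
  obtain ⟨P, hP⟩ := hf
  obtain ⟨Q, hQ⟩ := hg
  exact ⟨P * Q, fun x => by simp [hP, hQ]⟩
lemma PM.pow {f : (I → ℂ) → MvPolynomial (Fin 3) ℂ} (hf : PM f) (n : ℕ) :
    PM (fun x => f x ^ n) := by
  obtain ⟨P, hP⟩ := hf
  exact ⟨P ^ n, fun x => by simp [hP]⟩
lemma PM.sum {ι : Type*} (s : Finset ι) {f : ι → (I → ℂ) → MvPolynomial (Fin 3) ℂ}
    (hf : ∀ i ∈ s, PM (f i)) : PM (fun x => ∑ i ∈ s, f i x) := by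
  classical
  choose! P hP using hf
  exact ⟨∑ i ∈ s, P i, fun x => by
    rw [map_sum]; exact Finset.sum_congr rfl fun i hi => hP i hi x⟩
lemma PM.prod {ι : Type*} (s : Finset ι) {f : ι → (I → ℂ) → MvPolynomial (Fin 3) ℂ}
    (hf : ∀ i ∈ s, PM (f i)) : PM (fun x => ∏ i ∈ s, f i x) := by
  classical
  choose! P hP using hf
  exact ⟨∏ i ∈ s, P i, fun x => by
    rw [map_prod]; exact Finset.prod_congr rfl fun i hi => hP i hi x⟩
lemma PM.coeff {f : (I → ℂ) → MvPolynomial (Fin 3) ℂ} (hf : PM f) (m : Fin 3 →₀ ℕ) :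
    PF (fun x => (f x).coeff m) := by
  obtain ⟨P, hP⟩ := hf
  exact ⟨P.coeff m, fun x => by simp [hP, MvPolynomial.coeff_map]⟩
lemma PM.pderiv {f : (I → ℂ) → MvPolynomial (Fin 3) ℂ} (hf : PM f) (i : Fin 3) :
    PM (fun x => MvPolynomial.pderiv i (f x)) := by
  obtain ⟨P, hP⟩ := hf
  exact ⟨MvPolynomial.pderiv i P, fun x => by simp only [hP, MvPolynomial.pderiv_map]⟩
lemma PM.eval {f : (I → ℂ) → MvPolynomial (Fin 3) ℂ} (hf : PM f) {v : Fin 3 → (I → ℂ) → ℂ}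
    (hv : ∀ i, PF (v i)) : PF (fun x => MvPolynomial.eval (fun i => v i x) (f x)) := by
  obtain ⟨P, hP⟩ := hf
  choose V hV using hv
  refine ⟨MvPolynomial.eval V P, fun x => ?_⟩
  simp only [hP, hV]
  induction P using MvPolynomial.induction_on generalizing f with
  | C a => simp
  | add p q h1 h2 =>
    simp only [map_add]
    rw [h1 (f := fun x => MvPolynomial.map (MvPolynomial.eval x) p) (fun _ => rfl),
      h2 (f := fun x => MvPolynomial.map (MvPolynomial.eval x) q) (fun _ => rfl)]
  | mul_X p i h1 =>
    simp only [map_mul]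
    rw [h1 (f := fun x => MvPolynomial.map (MvPolynomial.eval x) p) (fun _ => rfl)]
    simp

/-! ## Restriction to lines -/

lemma PM.lp {f : (I → ℂ) → MvPolynomial (Fin 3) ℂ} (hf : PM f)
    {v w : Fin 3 → (I → ℂ) → ℂ} (hv : ∀ i, PF (v i)) (hw : ∀ i, PF (w i)) :
    PP (fun x => linePoly (f x) (fun i => v i x) (fun i => w i x)) := by
  obtain ⟨P, hP⟩ := hf
  choose V hV using hv
  choose W hW using hw
  refine ⟨MvPolynomial.aeval (fun i => Polynomial.C (V i) + Polynomial.X * Polynomial.C (W i)) P,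
    fun x => ?_⟩
  simp only [hP, hV, hW, linePoly]
  induction P using MvPolynomial.induction_on generalizing f with
  | C a =>
    simp
  | add p q h1 h2 =>
    simp only [map_add, Polynomial.map_add]
    rw [h1 (f := fun x => MvPolynomial.map (MvPolynomial.eval x) p) (fun _ => rfl),
      h2 (f := fun x => MvPolynomial.map (MvPolynomial.eval x) q) (fun _ => rfl)]
  | mul_X p i h1 =>
    simp only [map_mul, Polynomial.map_mul]
    rw [h1 (f := fun x => MvPolynomial.map (MvPolynomial.eval x) p) (fun _ => rfl)]
    simp

end PFsec

end

section

open Polynomial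

abbrev Form := MvPolynomial (Fin 3) ℂ

lemma eval_linePoly (F : Form) (v w : Fin 3 → ℂ) (t : ℂ) :
    (linePoly F v w).eval t = MvPolynomial.eval (v + t • w) F := by
  unfold linePoly
  induction F using MvPolynomial.induction_on with
  | C a => simp
  | add p q h1 h2 => simp only [map_add, Polynomial.eval_add, h1, h2]
  | mul_X p i h1 => 
    simp only [map_mul, Polynomial.eval_mul, h1]; simp; exact Or.inl (mul_comm _ _)

lemma linePoly_add (F G : Form) (v w : Fin 3 → ℂ) :
    linePoly (F + G) v w = linePoly F v w + linePoly G v w := by simp [linePoly]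
lemma linePoly_sub (F G : Form) (v w : Fin 3 → ℂ) :
    linePoly (F - G) v w = linePoly F v w - linePoly G v w := by simp [linePoly]
lemma linePoly_C_mul (a : ℂ) (F : Form) (v w : Fin 3 → ℂ) :
    linePoly (MvPolynomial.C a * F) v w = C a * linePoly F v w := by
  simp [linePoly]
lemma linePoly_smul (a : ℂ) (F : Form) (v w : Fin 3 → ℂ) :
    linePoly (a • F) v w = C a * linePoly F v w := by
  rw [MvPolynomial.smul_eq_C_mul, linePoly_C_mul]

/-- gradient -/
def gr (F : Form) (p : Fin 3 → ℂ) : Fin 3 → ℂ := fun i =>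
  MvPolynomial.eval p (MvPolynomial.pderiv i F)

lemma eval_derivative_linePoly (F : Form) (v w : Fin 3 → ℂ) (t : ℂ) :
    (derivative (linePoly F v w)).eval t = gr F (v + t • w) ⬝ᵥ w := by
  unfold linePoly gr
  induction F using MvPolynomial.induction_on with
  | C a => simp
  | add p q h1 h2 => 
    simp only [map_add, Polynomial.eval_add, h1, h2]
    rw [← add_dotProduct]; rfl
  | mul_X p i h1 =>
    have h2 := eval_linePoly p v w t
    unfold linePoly at h2
    simp only [map_mul, derivative_mul, Polynomial.eval_add, Polynomial.eval_mul, h1, h2,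
      MvPolynomial.aeval_X]
    simp only [dotProduct, Fin.sum_univ_three, Derivation.leibniz, MvPolynomial.pderiv_X]
    fin_cases i <;> simp <;> ring

lemma coeff_zero_linePoly (F : Form) (v w : Fin 3 → ℂ) :
    (linePoly F v w).coeff 0 = MvPolynomial.eval v F := by
  rw [coeff_zero_eq_eval_zero, eval_linePoly]; simp
lemma coeff_one_linePoly (F : Form) (v w : Fin 3 → ℂ) :
    (linePoly F v w).coeff 1 = gr F v ⬝ᵥ w := by
  have := eval_derivative_linePoly F v w 0
  rw [← coeff_zero_eq_eval_zero, coeff_derivative] at this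
  simpa using this

lemma X_sq_dvd_iff (f : ℂ[X]) : X ^ 2 ∣ f ↔ f.coeff 0 = 0 ∧ f.coeff 1 = 0 := by
  rw [X_pow_dvd_iff]
  constructor
  · intro h
    exact ⟨h 0 (by norm_num), h 1 (by norm_num)⟩
  · rintro ⟨h0, h1⟩ d hd
    interval_cases d <;> assumption

lemma sq_dvd_iff (f : ℂ[X]) (a : ℂ) :
    (X - C a) ^ 2 ∣ f ↔ f.eval a = 0 ∧ (derivative f).eval a = 0 := by
  by_cases hf : f = 0
  · simp [hf]
  rw [← le_rootMultiplicity_iff hf]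
  exact Polynomial.one_lt_rootMultiplicity_iff_isRoot hf

lemma X_sq_dvd_linePoly (F : Form) (v w : Fin 3 → ℂ) :
    X ^ 2 ∣ linePoly F v w ↔ MvPolynomial.eval v F = 0 ∧ gr F v ⬝ᵥ w = 0 := by
  rw [X_sq_dvd_iff, coeff_zero_linePoly, coeff_one_linePoly]

lemma linePoly_eq_sum (F : Form) (v w : Fin 3 → ℂ) :
    linePoly F v w = ∑ m ∈ F.support, C (F.coeff m) * ∏ i, (C (v i) + X * C (w i)) ^ m i := by
  unfold linePoly
  rw [MvPolynomial.aeval_def, MvPolynomial.eval₂_eq']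
  rfl

section hom
variable {d : ℕ} {F : Form} (hF : F.IsHomogeneous d)
include hF

lemma hom_sum_eq {m : Fin 3 →₀ ℕ} (hm : m ∈ F.support) : ∑ i, m i = d := by
  have := hF (MvPolynomial.mem_support_iff.1 hm)
  rw [← this, Finsupp.weight_apply, Finsupp.sum_fintype _ _ (by simp)]
  simp

lemma eval_hom (c : ℂ) (v : Fin 3 → ℂ) :
    MvPolynomial.eval (c • v) F = c ^ d * MvPolynomial.eval v F := by
  rw [MvPolynomial.eval_eq', MvPolynomial.eval_eq', Finset.mul_sum]
  refine Finset.sum_congr rfl fun m hm => ?_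
  simp only [Pi.smul_apply, smul_eq_mul, mul_pow, Finset.prod_mul_distrib]
  rw [Finset.prod_pow_eq_pow_sum, hom_sum_eq hF hm]
  ring

lemma natDegree_linePoly_le (v w : Fin 3 → ℂ) : (linePoly F v w).natDegree ≤ d := by
  rw [linePoly_eq_sum]
  refine natDegree_sum_le_of_forall_le _ _ fun m hm => ?_
  refine (natDegree_C_mul_le _ _).trans ?_
  refine (natDegree_prod_le _ _).trans ?_
  rw [← hom_sum_eq hF hm]
  refine Finset.sum_le_sum fun i _ => ?_
  refine natDegree_pow_le.trans ?_
  have : (C (v i) + X * C (w i)).natDegree ≤ 1 := by compute_degree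
  nlinarith

omit hF in
lemma gr_hom (hF : F.IsHomogeneous d) (c : ℂ) (v : Fin 3 → ℂ) :
    gr F (c • v) = c ^ (d - 1) • gr F v := by
  ext i
  simp only [gr, Pi.smul_apply, smul_eq_mul]
  exact eval_hom (hF.pderiv) c v

lemma euler (v : Fin 3 → ℂ) : v ⬝ᵥ gr F v = d * MvPolynomial.eval v F := by
  have := congrArg (MvPolynomial.eval v) hF.sum_X_mul_pderiv
  simpa [dotProduct, gr] using this

omit hF in
lemma poly_eq_of_ne_zero {f g : ℂ[X]} (h : ∀ t, t ≠ 0 → f.eval t = g.eval t) : f = g := by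
  refine Polynomial.eq_of_infinite_eval_eq f g ?_
  refine Set.Infinite.mono (s := {0}ᶜ) (fun t ht => h t ht) ?_
  exact (Set.finite_singleton 0).infinite_compl

lemma linePoly_swap (v w : Fin 3 → ℂ) :
    linePoly F w v = reflect d (linePoly F v w) := by
  apply poly_eq_of_ne_zero
  intro t ht
  let _ : Invertible t⁻¹ := invertibleOfNonzero (inv_ne_zero ht)
  have h1 := eval₂_reflect_mul_pow (RingHom.id ℂ) t⁻¹ d (linePoly F v w)
    (natDegree_linePoly_le hF v w)
  rw [invOf_eq_inv, inv_inv, ← Polynomial.eval, ← Polynomial.eval, eval_linePoly] at h1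
  rw [eval_linePoly]
  have h2 : w + t • v = t • (v + t⁻¹ • w) := by
    rw [smul_add, smul_smul, mul_inv_cancel₀ ht, one_smul, add_comm]
  rw [h2, eval_hom hF, ← h1, mul_comm, mul_assoc, ← mul_pow, inv_mul_cancel₀ ht]
  simp

lemma coeff_d_linePoly (v w : Fin 3 → ℂ) :
    (linePoly F v w).coeff d = MvPolynomial.eval w F := by
  rw [linePoly_swap hF w v, coeff_reflect, revAt_le le_rfl, Nat.sub_self, coeff_zero_linePoly]

lemma coeff_d_sub_one_linePoly (hd : 1 ≤ d) (v w : Fin 3 → ℂ) :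
    (linePoly F v w).coeff (d - 1) = gr F w ⬝ᵥ v := by
  rw [linePoly_swap hF w v, coeff_reflect, revAt_le (Nat.sub_le _ _), ← coeff_one_linePoly]
  congr 1; omega

lemma linePoly_affine (w0 p : Fin 3 → ℂ) (θ η : ℂ) (hθ : θ ≠ 0) :
    linePoly F (θ • w0 + η • p) p =
      C (θ ^ d) * (linePoly F w0 p).comp (C θ⁻¹ * X + C (θ⁻¹ * η)) := by
  apply Polynomial.funext
  intro t
  simp only [eval_linePoly, eval_mul, eval_comp, eval_add, eval_C, eval_X]
  rw [← eval_hom hF]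
  congr 2
  ext i
  simp
  field_simp
  ring

/-- homogenized version of the restriction to a line -/
lemma eval_eq_sum (w p : Fin 3 → ℂ) (y z : ℂ) (hz : z ≠ 0) :
    MvPolynomial.eval (z • w + y • p) F =
      ∑ k ∈ Finset.range (d + 1), (linePoly F w p).coeff k * y ^ k * z ^ (d - k) := by
  have h2 : z • w + y • p = z • (w + (y / z) • p) := by
    rw [smul_add, smul_smul, mul_div_cancel₀ _ hz]
  rw [h2, eval_hom hF, ← eval_linePoly,
    eval_eq_sum_range' (Nat.lt_succ_of_le (natDegree_linePoly_le hF w p)), Finset.mul_sum]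
  refine Finset.sum_congr rfl fun k hk => ?_
  have : k ≤ d := Nat.lt_succ_iff.1 (Finset.mem_range.1 hk)
  obtain ⟨e, rfl⟩ := Nat.exists_eq_add_of_le this
  rw [Nat.add_sub_cancel_left, div_pow, pow_add]
  field_simp

end hom

end

section

open Polynomial

def Wv (F G : Form) (p : Fin 3 → ℂ) : Fin 3 → ℂ := crossProduct (gr F p) (gr G p)

/-- the member of the pencil through `p` -/
def Phi (F G : Form) (p : Fin 3 → ℂ) : Form :=
  MvPolynomial.C (MvPolynomial.eval p G) * F - MvPolynomial.C (MvPolynomial.eval p F) * G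

def fP (F G : Form) (p : Fin 3 → ℂ) : ℂ[X] := linePoly (Phi F G p) (Wv F G p) p

def Bit (F G : Form) (v : Fin 3 → ℂ) : Prop :=
  ∃ (l m : ℂ) (w : Fin 3 → ℂ), (l ≠ 0 ∨ m ≠ 0) ∧ LinearIndependent ℂ ![v, w] ∧
    X ^ 2 ∣ linePoly (l • F + m • G) v w ∧ X ^ 2 ∣ linePoly (l • F + m • G) w v

lemma gr_add (F G : Form) (p : Fin 3 → ℂ) : gr (F + G) p = gr F p + gr G p := by
  ext i; simp [gr]
lemma gr_sub (F G : Form) (p : Fin 3 → ℂ) : gr (F - G) p = gr F p - gr G p := by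
  ext i; simp [gr]
lemma gr_C_mul (a : ℂ) (F : Form) (p : Fin 3 → ℂ) :
    gr (MvPolynomial.C a * F) p = a • gr F p := by
  ext i; simp [gr]
lemma gr_smul (a : ℂ) (F : Form) (p : Fin 3 → ℂ) :
    gr (a • F) p = a • gr F p := by
  rw [MvPolynomial.smul_eq_C_mul, gr_C_mul]

lemma Phi_hom {d : ℕ} {F G : Form} (hF : F.IsHomogeneous d) (hG : G.IsHomogeneous d)
    (p : Fin 3 → ℂ) : (Phi F G p).IsHomogeneous d := by
  unfold Phi
  rw [← MvPolynomial.smul_eq_C_mul, ← MvPolynomial.smul_eq_C_mul]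
  exact ((MvPolynomial.homogeneousSubmodule (Fin 3) ℂ d).sub_mem
    (Submodule.smul_mem _ _ hF) (Submodule.smul_mem _ _ hG))

lemma eval_Phi (F G : Form) (p : Fin 3 → ℂ) : MvPolynomial.eval p (Phi F G p) = 0 := by
  simp [Phi]; ring

lemma gr_Phi (F G : Form) (p q : Fin 3 → ℂ) : gr (Phi F G p) q =
    MvPolynomial.eval p G • gr F q - MvPolynomial.eval p F • gr G q := by
  rw [Phi, gr_sub, gr_C_mul, gr_C_mul]

lemma cross_W {d : ℕ} {F G : Form} (hF : F.IsHomogeneous d) (hG : G.IsHomogeneous d)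
    (p : Fin 3 → ℂ) : crossProduct p (Wv F G p) = (d : ℂ) • gr (Phi F G p) p := by
  have h1 : crossProduct p (Wv F G p) = (p ⬝ᵥ gr G p) • gr F p - (p ⬝ᵥ gr F p) • gr G p := by
    unfold Wv
    ext i
    fin_cases i <;>
    simp [cross_apply, dotProduct, Fin.sum_univ_three] <;> ring
  rw [h1, euler hF, euler hG, gr_Phi, smul_sub, smul_smul, smul_smul]

lemma lin_alg (p W w : Fin 3 → ℂ) (h : crossProduct p W ≠ 0) (h2 : crossProduct p W ⬝ᵥ w = 0) :
    ∃ θ η : ℂ, w = θ • W + η • p := by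
  have hdet : (Matrix.of ![p, W, w]).det = 0 := by
    rw [← h2, Matrix.det_fin_three]
    simp [cross_apply, dotProduct, Fin.sum_univ_three]
    ring
  obtain ⟨v, hv, hv2⟩ := Matrix.exists_vecMul_eq_zero_iff.2 hdet
  have hs : v 0 • p + v 1 • W + v 2 • w = 0 := by
    rw [← hv2]
    ext i
    simp [Matrix.vecMul, dotProduct, Fin.sum_univ_three]
  have hli := crossProduct_ne_zero_iff_linearIndependent.1 h
  by_cases h3 : v 2 = 0
  · exfalso
    rw [LinearIndependent.pair_iff] at hli
    have := hli (v 0) (v 1) (by rw [h3] at hs; simpa using hs)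
    apply hv
    ext i
    fin_cases i
    · exact this.1
    · exact this.2
    · exact h3
  · refine ⟨- v 1 / v 2, - v 0 / v 2, ?_⟩
    have : v 2 • w = - v 1 • W + - v 0 • p := by
      rw [← sub_eq_zero, ← hs]; module
    rw [div_eq_inv_mul, div_eq_inv_mul, mul_smul, mul_smul, ← smul_add, ← this, smul_smul,
      inv_mul_cancel₀ h3, one_smul]

section main
variable {d : ℕ} {F G : Form} (hd : 2 ≤ d) (hF : F.IsHomogeneous d) (hG : G.IsHomogeneous d)
include hd hF hG

lemma gr_Phi_dot_W (p : Fin 3 → ℂ) : gr (Phi F G p) p ⬝ᵥ Wv F G p = 0 := by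
  have h : ((d : ℂ) • gr (Phi F G p) p) ⬝ᵥ Wv F G p = 0 := by
    rw [← cross_W hF hG]
    simp [cross_apply, dotProduct, Fin.sum_univ_three]
    ring
  rw [smul_dotProduct, smul_eq_mul] at h
  have : (d : ℂ) ≠ 0 := by
    simp; omega
  simpa [this] using h

lemma natDegree_fP_le (p : Fin 3 → ℂ) : (fP F G p).natDegree ≤ d - 2 := by
  have hP := Phi_hom hF hG p
  rw [natDegree_le_iff_coeff_eq_zero]
  intro N hN
  by_cases h1 : d < N
  · exact coeff_eq_zero_of_natDegree_lt ((natDegree_linePoly_le hP _ _).trans_lt h1)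
  have : N = d ∨ N = d - 1 := by omega
  rcases this with rfl | rfl
  · exact (coeff_d_linePoly hP _ _).trans (eval_Phi F G p)
  · exact (coeff_d_sub_one_linePoly hP (by omega) _ _).trans (gr_Phi_dot_W hd hF hG p)

lemma bit_iff (p : Fin 3 → ℂ) (hp : crossProduct p (Wv F G p) ≠ 0) :
    Bit F G p ↔ ∃ y, (X - C y) ^ 2 ∣ fP F G p := by
  have hP := Phi_hom hF hG p
  have hd0 : (d : ℂ) ≠ 0 := by simp; omega
  constructor
  · rintro ⟨l, m, w, hlm, hli, h1, h2⟩
    rw [X_sq_dvd_linePoly] at h1 h2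
    have hFG : MvPolynomial.eval p G ≠ 0 ∨ MvPolynomial.eval p F ≠ 0 := by
      by_contra! hc
      apply hp
      rw [cross_W hF hG, gr_Phi, hc.1, hc.2]; simp
    have h11 : l * MvPolynomial.eval p F + m * MvPolynomial.eval p G = 0 := by
      simpa using h1.1
    obtain ⟨c, hc, hc1, hc2⟩ : ∃ c : ℂ, c ≠ 0 ∧ l = c * MvPolynomial.eval p G ∧
        m = - c * MvPolynomial.eval p F := by
      rcases hFG with h | h
      · have hl : l ≠ 0 := by
          rintro rfl
          simp [h] at h11
          simp [h11] at hlm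
        refine ⟨l / MvPolynomial.eval p G, div_ne_zero hl h, by field_simp, ?_⟩
        field_simp
        linear_combination h11
      · have hl : m ≠ 0 := by
          rintro rfl
          simp [h] at h11
          simp [h11] at hlm
        refine ⟨- m / MvPolynomial.eval p F, div_ne_zero (neg_ne_zero.2 hl) h, ?_, ?_⟩
        · field_simp
          linear_combination h11
        · field_simp
    have hL : l • F + m • G = c • Phi F G p := by
      rw [hc1, hc2, Phi]
      simp only [MvPolynomial.smul_eq_C_mul, map_mul, map_neg]
      ring
    rw [hL, gr_smul] at h1 h2
    rw [smul_dotProduct, MvPolynomial.smul_eval, smul_eq_mul, mul_eq_zero, mul_eq_zero] at h1 h2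
    simp only [hc, false_or] at h1 h2
    obtain ⟨θ, η, hw⟩ := lin_alg p (Wv F G p) w hp (by
      rw [cross_W hF hG, smul_dotProduct, h1.2, smul_zero])
    have hθ : θ ≠ 0 := by
      rintro rfl
      rw [LinearIndependent.pair_iff] at hli
      have := hli η (-1) (by rw [hw]; simp)
      simp at this
    have hw' : Wv F G p + (η / θ) • p = θ⁻¹ • w := by
      rw [hw, smul_add, smul_smul, smul_smul, inv_mul_cancel₀ hθ, one_smul, div_eq_inv_mul]
    refine ⟨η / θ, ?_⟩
    rw [sq_dvd_iff]
    unfold fP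
    rw [eval_linePoly, eval_derivative_linePoly, hw', eval_hom hP, h2.1, gr_hom hP,
      smul_dotProduct, h2.2]
    simp
  · rintro ⟨y, hy⟩
    rw [sq_dvd_iff] at hy
    unfold fP at hy
    rw [eval_linePoly, eval_derivative_linePoly] at hy
    refine ⟨MvPolynomial.eval p G, - MvPolynomial.eval p F, Wv F G p + y • p, ?_, ?_, ?_⟩
    · by_contra! hc
      apply hp
      rw [neg_eq_zero] at hc
      rw [cross_W hF hG, gr_Phi, hc.1, hc.2]; simp
    · rw [← crossProduct_ne_zero_iff_linearIndependent]
      simpa using hp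
    · have hL : MvPolynomial.eval p G • F + - MvPolynomial.eval p F • G = Phi F G p := by
        simp [MvPolynomial.smul_eq_C_mul, Phi, sub_eq_add_neg]
      rw [hL, X_sq_dvd_linePoly, X_sq_dvd_linePoly]
      refine ⟨⟨eval_Phi F G p, ?_⟩, hy⟩
      rw [dotProduct_add, gr_Phi_dot_W hd hF hG, dotProduct_smul, dotProduct_comm, euler hP,
        eval_Phi]
      simp
end main

end

section

open Polynomial

lemma resultant_comp_scale (f g : ℂ[X]) (m n : ℕ) (b : ℂ) (hb : b ≠ 0) :
    resultant (f.comp (C b * X)) (g.comp (C b * X)) m n = b ^ (m * n) * resultant f g m n := by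
  let e : Fin (m + n) → ℂ := fun j => Fin.addCases (fun j₁ : Fin m => b ^ (j₁ : ℕ))
    (fun j₁ : Fin n => b ^ (j₁ : ℕ)) j
  have hM : (f.comp (C b * X)).sylvester (g.comp (C b * X)) m n * Matrix.diagonal e =
      Matrix.diagonal (fun i : Fin (m + n) => b ^ (i : ℕ)) * f.sylvester g m n := by
    ext i j
    rw [Matrix.mul_diagonal, Matrix.diagonal_mul]
    induction j using Fin.addCases with
    | left j =>
      simp only [sylvester, Matrix.of_apply, Fin.addCases_left, e, Set.mem_Icc,
        comp_C_mul_X_coeff]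
      split_ifs with h
      · rw [mul_assoc, ← pow_add, Nat.sub_add_cancel h.1, mul_comm]
      · simp
    | right j =>
      simp only [sylvester, Matrix.of_apply, Fin.addCases_right, e, Set.mem_Icc,
        comp_C_mul_X_coeff]
      split_ifs with h
      · rw [mul_assoc, ← pow_add, Nat.sub_add_cancel h.1, mul_comm]
      · simp
  have := congrArg Matrix.det hM
  rw [Matrix.det_mul, Matrix.det_mul, Matrix.det_diagonal, Matrix.det_diagonal,
    Fin.prod_univ_add, Fin.prod_univ_add] at this
  simp only [e, Fin.addCases_left, Fin.addCases_right, Fin.val_castAdd, Fin.val_natAdd,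
    pow_add, Finset.prod_mul_distrib, Finset.prod_const, Finset.card_univ, Fintype.card_fin] at this
  have h1 : (∏ i : Fin m, b ^ (i : ℕ)) * (∏ i : Fin n, b ^ (i : ℕ)) ≠ 0 :=
    mul_ne_zero (Finset.prod_ne_zero_iff.2 fun _ _ => pow_ne_zero _ hb)
      (Finset.prod_ne_zero_iff.2 fun _ _ => pow_ne_zero _ hb)
  unfold resultant
  apply mul_right_cancel₀ h1
  rw [this, pow_mul]
  ring

/-- a discriminant for polynomials of degree at most `n` -/
def dOf (n : ℕ) (f : ℂ[X]) : ℂ :=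
  resultant (derivative f) (C (n : ℂ) * f - X * derivative f) (n - 1) (n - 1)

lemma PP.dOf {I : Type*} {f : (I → ℂ) → ℂ[X]} (hf : PP f) (n : ℕ) :
    PF (fun x => _root_.dOf n (f x)) :=
  hf.derivative.resultant (((PP.const _).mul hf).sub ((PP.const _).mul hf.derivative)) _ _

lemma dOf_one (f : ℂ[X]) : dOf 1 f = 1 := by simp [dOf]

lemma dOf_scale (n : ℕ) (f : ℂ[X]) (a b : ℂ) (hb : b ≠ 0) :
    dOf n (C a * f.comp (C b * X)) =
      a ^ (2 * (n - 1)) * b ^ ((n - 1) + (n - 1) * (n - 1)) * dOf n f := by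
  have h1 : derivative (C a * f.comp (C b * X)) = C (a * b) * (derivative f).comp (C b * X) := by
    simp [derivative_comp]
    ring
  have h2 : C (n : ℂ) * (C a * f.comp (C b * X)) - X * derivative (C a * f.comp (C b * X)) =
      C a * (C (n : ℂ) * f - X * derivative f).comp (C b * X) := by
    rw [h1]
    simp only [sub_comp, mul_comp, C_comp, X_comp, map_mul]
    ring
  unfold dOf
  rw [h2, h1, resultant_C_mul_left, resultant_C_mul_right, resultant_comp_scale _ _ _ _ _ hb]
  ring

section
variable {n : ℕ} (hn : 1 ≤ n) {f : ℂ[X]} (hf : f.natDegree ≤ n)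
include hn hf

lemma natDegree_der_le : (derivative f).natDegree ≤ n - 1 :=
  (natDegree_derivative_le f).trans (Nat.sub_le_sub_right hf 1)

lemma coeff_h (i : ℕ) : (C (n : ℂ) * f - X * derivative f).coeff i = ((n : ℂ) - i) * f.coeff i := by
  cases i with
  | zero => simp
  | succ i => simp [coeff_derivative]; ring

lemma natDegree_h_le : (C (n : ℂ) * f - X * derivative f).natDegree ≤ n - 1 := by
  rw [natDegree_le_iff_coeff_eq_zero]
  intro N hN
  rw [coeff_h hn hf]
  by_cases h : N = n
  · simp [h]
  · rw [coeff_eq_zero_of_natDegree_lt (p := f) (by omega), mul_zero]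

lemma coeff_der_top : (derivative f).coeff (n - 1) = n * f.coeff n := by
  rw [coeff_derivative]
  obtain ⟨m, rfl⟩ := Nat.exists_eq_add_of_le' hn
  simp; ring

lemma natDegree_der_eq (hc : f.coeff n ≠ 0) : (derivative f).natDegree = n - 1 := by
  apply le_antisymm (natDegree_der_le hn hf)
  apply le_natDegree_of_ne_zero
  rw [coeff_der_top hn hf]
  have : (n : ℂ) ≠ 0 := by simp; omega
  exact mul_ne_zero this hc

lemma dOf_eq_prod (hc : f.coeff n ≠ 0) :
    dOf n f = (n * f.coeff n) ^ (n - 1) *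
      ((derivative f).roots.map fun y => (n : ℂ) * f.eval y).prod := by
  unfold dOf
  have h := resultant_eq_prod_eval (derivative f) (C (n : ℂ) * f - X * derivative f) (n - 1)
    (natDegree_h_le hn hf) (IsAlgClosed.splits _)
  rw [natDegree_der_eq hn hf hc] at h
  rw [h, leadingCoeff, natDegree_der_eq hn hf hc, coeff_der_top hn hf]
  congr 2
  apply Multiset.map_congr rfl
  intro y hy
  have : (derivative f).eval y = 0 := (mem_roots'.1 hy).2
  simp [this]

lemma dOf_eq_zero_iff (hc : f.coeff n ≠ 0 ∨ f.coeff (n - 1) ≠ 0) :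
    dOf n f = 0 ↔ ∃ y, (X - C y) ^ 2 ∣ f := by
  have hn0 : (n : ℂ) ≠ 0 := by simp; omega
  simp only [sq_dvd_iff]
  by_cases hc1 : f.coeff n ≠ 0
  · rw [dOf_eq_prod hn hf hc1, mul_eq_zero, or_iff_right (pow_ne_zero _ (mul_ne_zero hn0 hc1)),
      Multiset.prod_eq_zero_iff, Multiset.mem_map]
    have hd : derivative f ≠ 0 := by
      intro h
      have := coeff_der_top hn hf
      rw [h] at this
      simp [hn0] at this
      exact hc1 this
    constructor
    · rintro ⟨y, hy, h⟩
      exact ⟨y, by simpa [hn0] using h, (mem_roots'.1 hy).2⟩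
    · rintro ⟨y, h1, h2⟩
      exact ⟨y, mem_roots'.2 ⟨hd, h2⟩, by simp [h1]⟩
  · rw [not_not] at hc1
    have hc2 : f.coeff (n - 1) ≠ 0 := by simpa [hc1] using hc
    have htop : (C (n : ℂ) * f - X * derivative f).coeff (n - 1) = f.coeff (n - 1) := by
      rw [coeff_h hn hf, Nat.cast_sub hn]; simp
    set h := C (n : ℂ) * f - X * derivative f with hh
    have hdeg : h.natDegree = n - 1 := by
      apply le_antisymm (natDegree_h_le hn hf)
      apply le_natDegree_of_ne_zero
      rw [htop]; exact hc2
    have hh0 : h ≠ 0 := by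
      intro h0
      rw [h0] at htop
      exact hc2 htop.symm
    have hr := resultant_eq_prod_eval h (derivative f) (n - 1)
      (natDegree_der_le hn hf) (IsAlgClosed.splits _)
    rw [hdeg] at hr
    unfold dOf
    rw [← hh, resultant_comm, hr, mul_eq_zero, or_iff_right (pow_ne_zero _ (by simp)), mul_eq_zero,
      or_iff_right (pow_ne_zero _ (leadingCoeff_ne_zero.2 hh0)),
      Multiset.prod_eq_zero_iff, Multiset.mem_map]
    constructor
    · rintro ⟨y, hy, h⟩
      have h2 := (mem_roots'.1 hy).2
      rw [IsRoot, hh] at h2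
      refine ⟨y, ?_, h⟩
      simpa [h, hn0] using h2
    · rintro ⟨y, h1, h2⟩
      exact ⟨y, mem_roots'.2 ⟨hh0, by simp [hh, h1, h2]⟩, h2⟩
end

/-- Homogeneity of the discriminant in the point. -/
lemma fP_smul {d : ℕ} {F G : Form} (hd : 2 ≤ d) (hF : F.IsHomogeneous d) (hG : G.IsHomogeneous d)
    (p : Fin 3 → ℂ) (c : ℂ) (hc : c ≠ 0) :
    fP F G (c • p) = C (c ^ (d + (2 * d - 2) * d)) *
      (fP F G p).comp (C ((c ^ (2 * d - 3))⁻¹) * X) := by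
  have hW : Wv F G (c • p) = (c ^ (2 * d - 2)) • Wv F G p := by
    unfold Wv
    rw [gr_hom hF, gr_hom hG, map_smul, LinearMap.map_smul₂, smul_smul, ← pow_add]
    congr 2; omega
  have hPhi : Phi F G (c • p) = c ^ d • Phi F G p := by
    simp only [Phi, eval_hom hF, eval_hom hG, smul_sub, MvPolynomial.smul_eq_C_mul, map_mul,
      mul_assoc]
  have hP := Phi_hom hF hG p
  unfold fP
  rw [hW, hPhi, linePoly_smul]
  apply Polynomial.funext
  intro t
  simp only [eval_linePoly, eval_mul, eval_comp, eval_C, eval_X]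
  rw [pow_add, mul_assoc, pow_mul, ← eval_hom hP (c ^ (2 * d - 2))]
  refine congrArg (fun z => c ^ d * MvPolynomial.eval z (Phi F G p)) ?_
  ext i
  obtain ⟨e, rfl⟩ := Nat.exists_eq_add_of_le' hd
  have h1 : 2 * (e + 2) - 3 = 2 * e + 1 := by omega
  have h2 : 2 * (e + 2) - 2 = 2 * e + 1 + 1 := by omega
  simp only [h1, h2, Pi.add_apply, Pi.smul_apply, smul_eq_mul]
  rw [pow_succ (n := 2 * e + 1)]
  field_simp

lemma dOf_fP_smul (k : ℕ) {F G : Form} (hF : F.IsHomogeneous (k + 3))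
    (hG : G.IsHomogeneous (k + 3)) (p : Fin 3 → ℂ) (c : ℂ) (hc : c ≠ 0) :
    dOf (k + 1) (fP F G (c • p)) =
      c ^ (k * (2 * k ^ 2 + 17 * k + 27)) * dOf (k + 1) (fP F G p) := by
  rw [fP_smul (by omega) hF hG p c hc, dOf_scale _ _ _ _ (inv_ne_zero (pow_ne_zero _ hc))]
  congr 1
  have h1 : 2 * (k + 3) - 3 = 2 * k + 3 := by omega
  have h2 : 2 * (k + 3) - 2 = 2 * k + 4 := by omega
  rw [h1, h2, Nat.add_sub_cancel, inv_pow, ← pow_mul, ← pow_mul]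
  rw [mul_inv_eq_iff_eq_mul₀ (pow_ne_zero _ hc), ← pow_add]
  congr 1
  ring

lemma reverse_degree (N : ℕ) (p r : ℂ[X]) (h : ∀ t, t ≠ 0 → p.eval t = t ^ N * r.eval t⁻¹) :
    p.natDegree ≤ N ∧ p.coeff N = r.eval 0 := by
  set e := r.natDegree
  have hE : X ^ e * p = X ^ N * reflect e r := by
    apply poly_eq_of_ne_zero
    intro t ht
    let _ : Invertible t⁻¹ := invertibleOfNonzero (inv_ne_zero ht)
    have h1 := eval₂_reflect_mul_pow (RingHom.id ℂ) t⁻¹ e r le_rfl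
    rw [invOf_eq_inv, inv_inv, ← Polynomial.eval, ← Polynomial.eval] at h1
    simp only [eval_mul, eval_pow, eval_X]
    rw [h t ht, ← h1, inv_pow]
    field_simp
  constructor
  · by_cases hp : p = 0
    · simp [hp]
    have h1 := congrArg natDegree hE
    rw [natDegree_X_pow_mul _ hp] at h1
    have h2 : (X ^ N * reflect e r).natDegree ≤ N + e := by
      refine natDegree_mul_le.trans ?_
      rw [natDegree_X_pow]
      have := natDegree_reflect_le (N := e) (p := r)
      simp at this
      omega
    omega
  · have h1 := congrArg (fun q => q.coeff (N + e)) hE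
    simp only [coeff_X_pow_mul] at h1
    rw [add_comm N e, coeff_X_pow_mul', if_pos (by omega), coeff_reflect] at h1
    rw [h1, Nat.add_sub_cancel, revAt_le le_rfl, Nat.sub_self, coeff_zero_eq_eval_zero]

end

section

open Polynomial

lemma dim_lemma {J Θ : Type} [Fintype J] [Fintype Θ] (y : J → (Θ → ℂ) → ℂ) (hy : ∀ j, PF (y j))
    (hc : Fintype.card Θ < Fintype.card J) :
    ∃ ρ : MvPolynomial J ℂ, ρ ≠ 0 ∧ ∀ θ, MvPolynomial.eval (fun j => y j θ) ρ = 0 := by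
  choose Y hY using hy
  have h : ¬ AlgebraicIndependent ℂ Y := by
    intro h
    have := h.lift_cardinalMk_le_trdeg
    rw [MvPolynomial.trdeg_of_isDomain] at this
    simp at this
    omega
  rw [algebraicIndependent_iff] at h
  push Not at h
  obtain ⟨ρ, h1, h2⟩ := h
  refine ⟨ρ, h2, fun θ => ?_⟩
  have h3 := congrArg (MvPolynomial.eval θ) h1
  rw [map_zero] at h3
  rw [← h3]
  simp only [hY]
  exact (MvPolynomial.eval₂Hom_bind₁ (RingHom.id ℂ) θ Y ρ).symm

open Classical in
lemma CL {J Θ : Type} [Fintype J] [Fintype Θ] (S : Finset J) (Y : J → (Θ ⊕ J → ℂ) → ℂ)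
    (hY : ∀ j, PF (Y j)) (hc : Fintype.card Θ < S.card) :
    ∃ ρ : MvPolynomial J ℂ, ρ ≠ 0 ∧ ∀ (x : J → ℂ) (θ : Θ → ℂ),
      (∀ j ∈ S, x j = Y j (Sum.elim θ (fun j => if j ∈ S then 0 else x j))) →
      MvPolynomial.eval x ρ = 0 := by
  have key := dim_lemma (J := J) (Θ := Θ ⊕ {j // j ∉ S})
    (fun j z => if hj : j ∈ S then
        Y j (fun i => Sum.elim (fun t => z (Sum.inl t))
          (fun j' => if h : j' ∈ S then 0 else z (Sum.inr ⟨j', h⟩)) i)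
      else z (Sum.inr ⟨j, hj⟩)) ?_ ?_
  · obtain ⟨ρ, h0, h1⟩ := key
    refine ⟨ρ, h0, fun x θ hx => ?_⟩
    rw [← h1 (Sum.elim θ (fun j => x j))]
    congr 2
    ext j
    split_ifs with hj
    · rw [hx j hj]
      congr 1
    · rfl
  · intro j
    split_ifs with hj
    · refine (hY j).comp ?_
      rintro (t | j')
      · exact PF.var _
      · simp only [Sum.elim_inr]
        split_ifs with h
        · exact PF.const 0
        · exact PF.var _
    · exact PF.var _
  · rw [Fintype.card_sum, Fintype.card_subtype_compl, Fintype.card_coe]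
    have := S.card_le_univ
    omega

open Classical in
/-- the bad coefficient vectors: coefficients in `S0` are determined by parameters and the
other coefficients -/
def BadV {M Θ : Type} (S0 : Finset M) (Y : M → (Θ ⊕ M → ℂ) → ℂ) (b : M → ℂ) : Prop :=
  ∃ θ : Θ → ℂ, ∀ m ∈ S0, b m = Y m (Sum.elim θ (fun j => if j ∈ S0 then 0 else b j))

open Classical in
lemma CL1 {M Θ : Type} [Fintype M] [Fintype Θ] (S0 : Finset M) (Y : M → (Θ ⊕ M → ℂ) → ℂ)
    (hY : ∀ j, PF (Y j)) (hc : Fintype.card Θ + 1 < S0.card) :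
    ∃ ρ : MvPolynomial (M ⊕ M) ℂ, ρ ≠ 0 ∧ ∀ (x : M ⊕ M → ℂ), MvPolynomial.eval x ρ ≠ 0 →
      ∀ c : ℂ, ¬ BadV S0 Y (fun m => x (Sum.inl m) + c * x (Sum.inr m)) := by
  obtain ⟨ρ, h0, h1⟩ := CL (J := M ⊕ M) (Θ := Θ ⊕ Unit) (S0.map Function.Embedding.inl)
    (fun j z => Sum.elim (fun m => Y m (fun i => Sum.elim (fun t => z (Sum.inl (Sum.inl t)))
        (fun m' => if m' ∈ S0 then 0 else
          z (Sum.inr (Sum.inl m')) + z (Sum.inl (Sum.inr ())) * z (Sum.inr (Sum.inr m'))) i)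
        - z (Sum.inl (Sum.inr ())) * z (Sum.inr (Sum.inr m))) (fun _ => 0) j) (by
      rintro (m | m)
      · simp only [Sum.elim_inl]
        refine PF.sub ((hY m).comp ?_) ((PF.var _).mul (PF.var _))
        rintro (t | m')
        · exact PF.var _
        · simp only [Sum.elim_inr]
          exact PF.ite _ (PF.const _) ((PF.var _).add ((PF.var _).mul (PF.var _)))
      · exact PF.const 0) (by simpa using hc)
  refine ⟨ρ, h0, fun x hx c ⟨θ, hθ⟩ => hx (h1 x (Sum.elim θ (fun _ => c)) ?_)⟩
  intro j hj
  obtain ⟨m, hm, rfl⟩ := Finset.mem_map.1 hj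
  have h2 := hθ m hm
  simp only [Function.Embedding.inl_apply, Sum.elim_inl, Sum.elim_inr]
  have h3 : ∀ m' : M, (Sum.inr m' : M ⊕ M) ∉ S0.map Function.Embedding.inl := by simp
  have h4 : ∀ m' : M, (Sum.inl m' : M ⊕ M) ∈ S0.map Function.Embedding.inl ↔ m' ∈ S0 := by simp
  simp only [h3, h4, if_false]
  rw [eq_sub_iff_add_eq]
  refine h2.trans ?_
  congr 1
  ext i
  rcases i with t | m'
  · rfl
  · simp only [Sum.elim_inr]
    split_ifs <;> rfl

open Classical in
lemma CL2 {M Θ : Type} [Fintype M] [Fintype Θ] (S0 : Finset M) (Y : M → (Θ ⊕ M → ℂ) → ℂ)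
    (hY : ∀ j, PF (Y j)) (hc : Fintype.card Θ < S0.card) :
    ∃ ρ : MvPolynomial (M ⊕ M) ℂ, ρ ≠ 0 ∧ ∀ (x : M ⊕ M → ℂ), MvPolynomial.eval x ρ ≠ 0 →
      ¬ BadV S0 Y (fun m => x (Sum.inr m)) := by
  obtain ⟨ρ, h0, h1⟩ := CL S0 Y hY hc
  refine ⟨MvPolynomial.rename Sum.inr ρ, ?_, ?_⟩
  · rw [Ne, MvPolynomial.rename_eq_zero_iff_of_injective _ Sum.inr_injective]
    exact h0
  · rintro x hx ⟨θ, hθ⟩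
    rw [MvPolynomial.eval_rename] at hx
    exact hx (h1 _ θ hθ)

/-! ### forms with given coefficients -/

/-- exponents of degree `d` -/
abbrev Mon (d : ℕ) : Type := {m : Fin 3 →₀ ℕ // m ∈ (Finset.univ : Finset (Fin 3)).finsuppAntidiag d}

def formOf {d : ℕ} (b : Mon d → ℂ) : Form := ∑ m : Mon d, MvPolynomial.monomial m.1 (b m)

lemma Mon.sum_eq {d : ℕ} (m : Mon d) : m.1 0 + m.1 1 + m.1 2 = d := by
  have := (Finset.mem_finsuppAntidiag.1 m.2).1
  rwa [Fin.sum_univ_three] at this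

lemma mem_Mon {d : ℕ} {m : Fin 3 →₀ ℕ} (h : m 0 + m 1 + m 2 = d) :
    m ∈ (Finset.univ : Finset (Fin 3)).finsuppAntidiag d := by
  rw [Finset.mem_finsuppAntidiag, Fin.sum_univ_three]
  exact ⟨h, Finset.subset_univ _⟩

lemma formOf_hom {d : ℕ} (b : Mon d → ℂ) : (formOf b).IsHomogeneous d := by
  refine MvPolynomial.IsHomogeneous.sum _ _ _ fun m _ => ?_
  apply MvPolynomial.isHomogeneous_monomial
  rw [Finsupp.degree_eq_sum, Fin.sum_univ_three]
  exact m.sum_eq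

lemma formOf_coeff {d : ℕ} {F : Form} (hF : F.IsHomogeneous d) :
    formOf (fun m : Mon d => F.coeff m.1) = F := by
  classical
  ext m
  unfold formOf
  rw [MvPolynomial.coeff_sum]
  simp only [MvPolynomial.coeff_monomial]
  by_cases hm : m ∈ F.support
  · have h1 := hom_sum_eq hF hm
    rw [Fin.sum_univ_three] at h1
    rw [Finset.sum_eq_single (⟨m, mem_Mon h1⟩ : Mon d)]
    · simp
    · intro b _ hb
      rw [if_neg]
      rintro rfl
      exact hb rfl
    · simp
  · rw [MvPolynomial.notMem_support_iff.1 hm]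
    apply Finset.sum_eq_zero
    intro b _
    split_ifs with h
    · rw [h]; exact MvPolynomial.notMem_support_iff.1 hm
    · rfl

lemma coeff_formOf {d : ℕ} (b : Mon d → ℂ) (m : Mon d) : (formOf b).coeff m.1 = b m := by
  classical
  unfold formOf
  rw [MvPolynomial.coeff_sum]
  simp only [MvPolynomial.coeff_monomial]
  rw [Finset.sum_eq_single m]
  · simp
  · intro c _ hb
    rw [if_neg]
    intro h
    exact hb (Subtype.ext h)
  · simp

lemma formOf_add {d : ℕ} (b c : Mon d → ℂ) : formOf (fun m => b m + c m) = formOf b + formOf c := by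
  simp [formOf, Finset.sum_add_distrib]
lemma formOf_smul {d : ℕ} (a : ℂ) (b : Mon d → ℂ) : formOf (fun m => a * b m) = a • formOf b := by
  simp [formOf, Finset.smul_sum, MvPolynomial.smul_monomial]

lemma PM.formOf {I : Type*} {d : ℕ} {b : Mon d → (I → ℂ) → ℂ} (hb : ∀ m, PF (b m)) :
    PM (fun x => _root_.formOf (fun m => b m x)) := by
  choose B hB using hb
  refine ⟨∑ m : Mon d, MvPolynomial.monomial m.1 (B m), fun x => ?_⟩
  simp [_root_.formOf, map_sum, MvPolynomial.map_monomial, hB]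

/-! ### combining finitely many conditions -/
lemma exists_ne_zero_eval {I : Type*} {ρ : MvPolynomial I ℂ} (h : ρ ≠ 0) :
    ∃ x, MvPolynomial.eval x ρ ≠ 0 := by
  by_contra! hc
  exact h (MvPolynomial.funext fun x => by simp [hc])

end

section

open Polynomial

/-- polynomials with prescribed multiple roots -/
def Shape {k' : ℕ} (e : Fin k' → ℕ) (r : ℕ) (f : ℂ[X]) : Prop :=
  ∃ (a : Fin k' → ℂ) (q : ℂ[X]), q.degree < r ∧ f = (∏ i, (X - C (a i)) ^ e i) * q

def shp {k' : ℕ} (e : Fin k' → ℕ) (r : ℕ) (θ : Fin k' ⊕ Fin r → ℂ) : ℂ[X] :=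
  (∏ i, (X - C (θ (Sum.inl i))) ^ e i) * ∑ j : Fin r, C (θ (Sum.inr j)) * X ^ (j : ℕ)

lemma Shape.exists_shp {k' : ℕ} {e : Fin k' → ℕ} {r : ℕ} {f : ℂ[X]} (h : Shape e r f) :
    ∃ θ, f = shp e r θ := by
  obtain ⟨a, q, hq, rfl⟩ := h
  refine ⟨Sum.elim a (fun j => q.coeff j), ?_⟩
  simp only [shp, Sum.elim_inl, Sum.elim_inr]
  congr 1
  rw [Fin.sum_univ_eq_sum_range (fun j => C (q.coeff j) * X ^ j)]
  by_cases h0 : q = 0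
  · simp [h0]
  · exact as_sum_range_C_mul_X_pow' _ ((natDegree_lt_iff_degree_lt h0).2 hq)

lemma Shape.affine {k' : ℕ} {e : Fin k' → ℕ} {r : ℕ} {f : ℂ[X]} (h : Shape e r f) (t α β : ℂ)
    (hα : α ≠ 0) : Shape e r (C t * f.comp (C α * X + C β)) := by
  obtain ⟨a, q, hq, rfl⟩ := h
  have h1 : ∀ i, (X - C (a i)).comp (C α * X + C β) = C α * (X - C ((a i - β) / α)) := by
    intro i
    simp only [sub_comp, X_comp, C_comp]
    rw [mul_sub, ← C_mul, mul_div_cancel₀ _ hα, C_sub]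
    ring
  refine ⟨fun i => (a i - β) / α, C t * (∏ i, C α ^ e i) * q.comp (C α * X + C β), ?_, ?_⟩
  · have h2 : (C t * (∏ i, C α ^ e i) : ℂ[X]) = C (t * ∏ i, α ^ e i) := by
      simp [map_prod]
    rw [h2]
    by_cases h0 : q = 0
    · rw [h0]; simp
    rw [← natDegree_lt_iff_degree_lt h0] at hq
    refine lt_of_le_of_lt degree_le_natDegree ?_
    have : (C (t * ∏ i, α ^ e i) * q.comp (C α * X + C β)).natDegree ≤ q.natDegree := by
      refine (natDegree_C_mul_le _ _).trans ?_
      rw [natDegree_comp]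
      have : (C α * X + C β).natDegree ≤ 1 := by compute_degree
      nlinarith
    exact_mod_cast this.trans_lt hq
  · rw [mul_comp, Polynomial.prod_comp]
    simp only [pow_comp, h1, mul_pow, Finset.prod_mul_distrib]
    ring

lemma PP.shp {I : Type*} {k' : ℕ} (e : Fin k' → ℕ) (r : ℕ) {θ : Fin k' ⊕ Fin r → (I → ℂ) → ℂ}
    (h : ∀ i, PF (θ i)) : PP (fun x => _root_.shp e r (fun i => θ i x)) := by
  unfold _root_.shp
  refine PP.mul (PP.prod _ fun i _ => ((PP.const _).sub (PP.C (h _))).pow _)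
    (PP.sum _ fun i _ => (PP.C (h _)).mul (PP.const _))

lemma linePoly_formOf {d : ℕ} (b : Mon d → ℂ) (v w : Fin 3 → ℂ) :
    linePoly (formOf b) v w = ∑ m : Mon d, C (b m) * ∏ i, (C (v i) + X * C (w i)) ^ m.1 i := by
  unfold formOf linePoly
  rw [map_sum]
  refine Finset.sum_congr rfl fun m _ => ?_
  rw [MvPolynomial.aeval_monomial, Finsupp.prod_fintype _ _ (by simp)]
  rfl

lemma PF.vec3 {I : Type*} {a b c : (I → ℂ) → ℂ} (ha : PF a) (hb : PF b) (hc : PF c) (i : Fin 3) :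
    PF (fun x => (![a x, b x, c x] : Fin 3 → ℂ) i) := by
  fin_cases i
  · exact ha
  · exact hb
  · exact hc

/-- monomial with given exponents -/
def mk3 {d : ℕ} (i j k : ℕ) (h : i + j + k = d) : Mon d :=
  ⟨Finsupp.equivFunOnFinite.symm ![i, j, k], mem_Mon h⟩

open Classical in
def SK (d : ℕ) : Finset (Mon d) := Finset.univ.filter fun m => m.1 1 = 0
open Classical in
def SH (d : ℕ) : Finset (Mon d) := Finset.univ.filter fun m => m.1 2 = 0

lemma card_SK (d : ℕ) : d + 1 ≤ (SK d).card := by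
  classical
  rw [← Finset.card_fin (d + 1)]
  refine Finset.card_le_card_of_injOn
    (fun k => mk3 k.1 0 (d - k.1) (by omega)) ?_ ?_
  · intro k _
    simp [SK, mk3]
  · intro k _ l _ h
    have := congrArg (fun m : Mon d => m.1 0) h
    simpa [mk3, Fin.ext_iff] using this

lemma card_SH (d : ℕ) : d + 1 ≤ (SH d).card := by
  classical
  rw [← Finset.card_fin (d + 1)]
  refine Finset.card_le_card_of_injOn
    (fun k => mk3 k.1 (d - k.1) 0 (by omega)) ?_ ?_
  · intro k _
    simp [SH, mk3]
  · intro k _ l _ h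
    have := congrArg (fun m : Mon d => m.1 0) h
    simpa [mk3, Fin.ext_iff] using this

lemma Mon.ext' {d : ℕ} {m m' : Mon d} (h0 : m.1 0 = m'.1 0) (h1 : m.1 1 = m'.1 1)
    (h2 : m.1 2 = m'.1 2) : m = m' := by
  apply Subtype.ext
  ext i
  fin_cases i
  exacts [h0, h1, h2]

lemma BadV.intro {M Θ : Type} {S0 : Finset M} {Y : M → (Θ ⊕ M → ℂ) → ℂ} {b : M → ℂ} (θ : Θ → ℂ)
    (h : ∀ b0 : M → ℂ, (∀ j ∈ S0, b0 j = 0) → (∀ j, j ∉ S0 → b0 j = b j) →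
      ∀ m ∈ S0, b m = Y m (Sum.elim θ b0)) : BadV S0 Y b := by
  refine ⟨θ, h _ ?_ ?_⟩
  · intro j hj; rw [if_pos hj]
  · intro j hj; rw [if_neg hj]

section modes
variable {d k' : ℕ} (e : Fin k' → ℕ) (r : ℕ)

def YK (m : Mon d) (z : ((Fin 2 ⊕ (Fin k' ⊕ Fin r)) ⊕ Mon d) → ℂ) : ℂ :=
  (shp e r (fun i => z (Sum.inl (Sum.inr i)))).coeff (m.1 0) -
    (linePoly (formOf (fun m => z (Sum.inr m))) (fun i => ![0, z (Sum.inl (Sum.inl 0)), 1] i)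
      (fun i => ![1, z (Sum.inl (Sum.inl 1)), 0] i)).coeff (m.1 0)

lemma PF_YK (m : Mon d) : PF (YK e r m) := by
  unfold YK
  refine PF.sub ((PP.shp e r fun i => PF.var _).coeff _) ?_
  refine PP.coeff (PM.lp (PM.formOf fun m => PF.var _) ?_ ?_) _
  · exact PF.vec3 (PF.const _) (PF.var _) (PF.const _)
  · exact PF.vec3 (PF.const _) (PF.var _) (PF.const _)

lemma bad_K (b : Mon d → ℂ) (s κ : ℂ)
    (h : Shape e r (linePoly (formOf b) ![0, κ, 1] ![1, s, 0])) :
    BadV (SK d) (YK e r) b := by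
  classical
  obtain ⟨θ, hθ⟩ := h.exists_shp
  refine BadV.intro (Sum.elim ![κ, s] θ) fun b0 hb0 hb1 m hm => ?_
  unfold YK
  simp only [Sum.elim_inl, Sum.elim_inr]
  have h1 : formOf b = formOf b0 + formOf (fun j => b j - b0 j) := by
    rw [← formOf_add]
    congr 1
    ext j
    ring
  have hbS : ∀ j ∈ SK d, b j - b0 j = b j := fun j hj => by rw [hb0 j hj, sub_zero]
  have hbN : ∀ j, j ∉ SK d → b j - b0 j = 0 := fun j hj => by rw [hb1 j hj, sub_self]
  have h2 : (linePoly (formOf (fun j => b j - b0 j)) ![0, κ, 1]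
      ![1, s, 0]).coeff (m.1 0) = b m := by
    rw [linePoly_formOf, finsetSum_coeff, Finset.sum_eq_single m]
    · rw [hbS m hm]
      have : m.1 1 = 0 := by simpa [SK] using hm
      simp [Fin.prod_univ_three, this]
    · intro m' _ hne
      by_cases hm' : m' ∈ SK d
      · rw [hbS m' hm']
        have h3 : m.1 1 = 0 := by simpa [SK] using hm
        have h4 : m'.1 1 = 0 := by simpa [SK] using hm'
        simp [Fin.prod_univ_three, h4, coeff_X_pow]
        intro h5
        exfalso
        apply hne
        have := m.sum_eq
        have := m'.sum_eq
        exact Mon.ext' (by omega) (by omega) (by omega)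
      · rw [hbN m' hm']; simp
    · simp
  rw [h1, linePoly_add] at hθ
  have h3 := congrArg (fun q => q.coeff (m.1 0)) hθ
  simp only [coeff_add, h2] at h3
  rw [← h3]
  simp only [Matrix.cons_val_zero, Matrix.cons_val_one]
  exact (add_sub_cancel_left _ _).symm

def YH (m : Mon d) (z : ((Fin 1 ⊕ (Fin k' ⊕ Fin r)) ⊕ Mon d) → ℂ) : ℂ :=
  (∑ k ∈ Finset.range (d + 1), C ((shp e r (fun i => z (Sum.inl (Sum.inr i)))).coeff k) * X ^ k *
    (1 - C (z (Sum.inl (Sum.inl 0))) * X) ^ (d - k)).coeff (m.1 0)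

lemma PF_YH (m : Mon d) : PF (YH e r m) := by
  unfold YH
  refine PP.coeff (PP.sum _ fun k _ => ?_) _
  refine PP.mul (PP.mul (PP.C (PP.coeff (PP.shp e r fun i => PF.var _) _)) (PP.const _)) ?_
  exact PP.pow (PP.sub (PP.const _) (PP.mul (PP.C (PF.var _)) (PP.const _))) _

lemma coeff_SH (b : Mon d → ℂ) (m : Mon d) (hm : m ∈ SH d) :
    (linePoly (formOf b) ![0, 1, 0] ![1, 0, 0]).coeff (m.1 0) = b m := by
  classical
  have h3 : m.1 2 = 0 := by simpa [SH] using hm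
  rw [linePoly_formOf, finsetSum_coeff, Finset.sum_eq_single m]
  · simp [Fin.prod_univ_three, h3]
  · intro m' _ hne
    by_cases h4 : m'.1 2 = 0
    · simp [Fin.prod_univ_three, h4, coeff_X_pow]
      intro h5
      exfalso
      apply hne
      have := m.sum_eq
      have := m'.sum_eq
      exact Mon.ext' (by omega) (by omega) (by omega)
    · simp [Fin.prod_univ_three, h4]
  · simp

lemma linePoly_shift {F : Form} (hF : F.IsHomogeneous d) (s : ℂ) :
    linePoly F ![0, 1, 0] ![1, 0, 0] = ∑ k ∈ Finset.range (d + 1),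
      C ((linePoly F ![0, 1, 0] ![1, s, 0]).coeff k) * X ^ k * (1 - C s * X) ^ (d - k) := by
  refine Polynomial.eq_of_infinite_eval_eq _ _ ?_
  have hne : (1 - C s * X : ℂ[X]) ≠ 0 := by
    intro h0
    have := congrArg (Polynomial.eval 0) h0
    simp at this
  refine Set.Infinite.mono (s := {y | (1 - C s * X : ℂ[X]).eval y = 0}ᶜ) ?_ ?_
  · intro y hy
    have hy' : 1 - s * y ≠ 0 := by simpa using hy
    have h5 := eval_eq_sum hF ![0, 1, 0] ![1, s, 0] y (1 - s * y) hy'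
    have hv : (![0, 1, 0] + y • ![1, 0, 0] : Fin 3 → ℂ) =
        (1 - s * y) • ![0, 1, 0] + y • ![1, s, 0] := by
      ext i
      fin_cases i
      · simp
      · simp
        ring
      · simp
    rw [Set.mem_ofPred_eq, eval_linePoly, hv, h5, eval_finsetSum]
    simp only [eval_mul, eval_C, eval_pow, eval_X, eval_sub, eval_one]
  · apply Set.Finite.infinite_compl
    refine Set.Finite.subset (1 - C s * X : ℂ[X]).roots.toFinset.finite_toSet ?_
    intro y hy
    simp only [Finset.mem_coe, Multiset.mem_toFinset]
    exact mem_roots'.2 ⟨hne, hy⟩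

lemma bad_H (b : Mon d → ℂ) (s : ℂ)
    (h : Shape e r (linePoly (formOf b) ![0, 1, 0] ![1, s, 0])) :
    BadV (SH d) (YH e r) b := by
  obtain ⟨θ, hθ⟩ := h.exists_shp
  refine BadV.intro (Sum.elim (fun _ => s) θ) fun b0 hb0 hb1 m hm => ?_
  unfold YH
  simp only [Sum.elim_inl, Sum.elim_inr]
  rw [← coeff_SH b m hm, linePoly_shift (formOf_hom b) s, hθ]

end modes

end

section

open Polynomial

/-- affine first coordinate of the line at height `s` -/
abbrev pt (s : ℂ) : Fin 3 → ℂ := ![1, s, 0]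

abbrev FF {d : ℕ} (x : Mon d ⊕ Mon d → ℂ) : Form := formOf (fun m => x (Sum.inl m))
abbrev GG {d : ℕ} (x : Mon d ⊕ Mon d → ℂ) : Form := formOf (fun m => x (Sum.inr m))

lemma Shape.smul {k' : ℕ} {e : Fin k' → ℕ} {r : ℕ} {f : ℂ[X]} (h : Shape e r f) (t : ℂ) :
    Shape e r (t • f) := by
  have := h.affine t 1 0 one_ne_zero
  simpa [smul_eq_C_mul] using this

lemma shape_K {d k' r : ℕ} {e : Fin k' → ℕ} {H : Form} (hH : H.IsHomogeneous d) {s : ℂ}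
    {w : Fin 3 → ℂ} (hw : w 2 ≠ 0) (h : Shape e r (linePoly H w (pt s))) :
    Shape e r (linePoly H ![0, (w 1 - w 0 * s) / w 2, 1] (pt s)) := by
  have hv : (![0, (w 1 - w 0 * s) / w 2, 1] : Fin 3 → ℂ) = (w 2)⁻¹ • w + (-((w 2)⁻¹ * w 0)) • pt s := by
    ext i
    fin_cases i
    · simp
    · simp; field_simp; ring
    · simp [hw]
  rw [hv, linePoly_affine hH _ _ _ _ (inv_ne_zero hw)]
  exact h.affine _ _ _ (inv_ne_zero (inv_ne_zero hw))

lemma shape_H {d k' r : ℕ} {e : Fin k' → ℕ} {H : Form} (hH : H.IsHomogeneous d) {s : ℂ}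
    {w : Fin 3 → ℂ} (hw : w 2 = 0) (hl : LinearIndependent ℂ ![pt s, w])
    (h : Shape e r (linePoly H w (pt s))) :
    Shape e r (linePoly H ![0, 1, 0] (pt s)) := by
  have hθ : w 1 - w 0 * s ≠ 0 := by
    intro h0
    rw [LinearIndependent.pair_iff] at hl
    have := hl (w 0) (-1) (by
      ext i
      fin_cases i
      · simp
      · simp; linear_combination -h0
      · simp [hw])
    simp at this
  have hv : (![0, 1, 0] : Fin 3 → ℂ) = (w 1 - w 0 * s)⁻¹ • w + (-((w 1 - w 0 * s)⁻¹ * w 0)) • pt s := by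
    ext i
    fin_cases i
    · simp
    · simp; field_simp; ring
    · simp [hw]
  rw [hv, linePoly_affine hH _ _ _ _ (inv_ne_zero hθ)]
  exact h.affine _ _ _ (inv_ne_zero (inv_ne_zero hθ))

lemma member_cases {d k' r : ℕ} {e : Fin k' → ℕ} (x : Mon d ⊕ Mon d → ℂ) (v w : Fin 3 → ℂ)
    (l m : ℂ) (hlm : l ≠ 0 ∨ m ≠ 0) (h : Shape e r (linePoly (l • FF x + m • GG x) v w)) :
    (l ≠ 0 ∧ ∃ c : ℂ, Shape e r (linePoly (formOf fun j => x (Sum.inl j) + c * x (Sum.inr j)) v w)) ∨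
    (l = 0 ∧ Shape e r (linePoly (GG x) v w)) := by
  by_cases hl : l = 0
  · right
    refine ⟨hl, ?_⟩
    have hm : m ≠ 0 := by tauto
    have := h.smul m⁻¹
    rw [hl, zero_smul, zero_add, linePoly_smul, ← smul_eq_C_mul, smul_smul, inv_mul_cancel₀ hm, one_smul] at this
    exact this
  · left
    refine ⟨hl, m / l, ?_⟩
    have := h.smul l⁻¹
    rw [smul_eq_C_mul, ← linePoly_smul, smul_add, smul_smul, smul_smul, inv_mul_cancel₀ hl, one_smul,
      ← formOf_smul, ← formOf_add] at this
    rwa [div_eq_inv_mul]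

lemma notShape_weak {d k' : ℕ} (e : Fin k' → ℕ) (r : ℕ) (hc : k' + r + 2 ≤ d) :
    ∃ ρ : MvPolynomial (Mon d ⊕ Mon d) ℂ, ρ ≠ 0 ∧ ∀ x, MvPolynomial.eval x ρ ≠ 0 →
      ∀ (s l m : ℂ) (w : Fin 3 → ℂ), (l ≠ 0 ∨ m ≠ 0) → LinearIndependent ℂ ![pt s, w] →
        (l = 0 ∨ w 2 = 0) → ¬ Shape e r (linePoly (l • FF x + m • GG x) w (pt s)) := by
  obtain ⟨ρ1, h1, k1⟩ := CL2 (SK d) (YK e r) (PF_YK e r) (by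
    have := card_SK d; simp; omega)
  obtain ⟨ρ2, h2, k2⟩ := CL1 (SH d) (YH e r) (PF_YH e r) (by
    have := card_SH d; simp; omega)
  obtain ⟨ρ3, h3, k3⟩ := CL2 (SH d) (YH e r) (PF_YH e r) (by
    have := card_SH d; simp; omega)
  refine ⟨ρ1 * ρ2 * ρ3, mul_ne_zero (mul_ne_zero h1 h2) h3, fun x hx s l m w hlm hli hor hS => ?_⟩
  simp only [map_mul, ne_eq, mul_eq_zero, not_or] at hx
  obtain ⟨⟨g1, g2⟩, g3⟩ := hx
  by_cases hw : w 2 = 0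
  · rcases member_cases x _ _ l m hlm hS with ⟨_, c, hc⟩ | ⟨_, hc⟩
    · exact k2 x g2 c (bad_H e r _ s (shape_H (formOf_hom _) hw hli hc))
    · exact k3 x g3 (bad_H e r _ s (shape_H (formOf_hom _) hw hli hc))
  · have hl : l = 0 := by tauto
    rcases member_cases x _ _ l m hlm hS with ⟨hl', c, hc⟩ | ⟨_, hc⟩
    · exact hl' hl
    · exact k1 x g1 (bad_K e r _ s _ (shape_K (formOf_hom _) hw hc))

lemma notShape {d k' : ℕ} (e : Fin k' → ℕ) (r : ℕ) (hc : k' + r + 3 ≤ d) :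
    ∃ ρ : MvPolynomial (Mon d ⊕ Mon d) ℂ, ρ ≠ 0 ∧ ∀ x, MvPolynomial.eval x ρ ≠ 0 →
      ∀ (s l m : ℂ) (w : Fin 3 → ℂ), (l ≠ 0 ∨ m ≠ 0) → LinearIndependent ℂ ![pt s, w] →
        ¬ Shape e r (linePoly (l • FF x + m • GG x) w (pt s)) := by
  obtain ⟨ρ1, h1, k1⟩ := CL1 (SK d) (YK e r) (PF_YK e r) (by
    have := card_SK d; simp; omega)
  obtain ⟨ρ2, h2, k2⟩ := notShape_weak (d := d) e r (by omega)
  refine ⟨ρ1 * ρ2, mul_ne_zero h1 h2, fun x hx s l m w hlm hli hS => ?_⟩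
  simp only [map_mul, ne_eq, mul_eq_zero, not_or] at hx
  by_cases hor : l = 0 ∨ w 2 = 0
  · exact k2 x hx.2 s l m w hlm hli hor hS
  · push Not at hor
    rcases member_cases x _ _ l m hlm hS with ⟨hl', c, hc⟩ | ⟨hl, _⟩
    · exact k1 x hx.1 c (bad_K e r _ s _ (shape_K (formOf_hom _) hor.2 hc))
    · exact hor.1 hl

lemma Phi_eq (F G : Form) (p : Fin 3 → ℂ) :
    Phi F G p = MvPolynomial.eval p G • F + (- MvPolynomial.eval p F) • G := by
  simp [MvPolynomial.smul_eq_C_mul, Phi, sub_eq_add_neg]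

lemma not_base_of_cross {d : ℕ} {F G : Form} (hF : F.IsHomogeneous d) (hG : G.IsHomogeneous d)
    (p : Fin 3 → ℂ) (hp : crossProduct p (Wv F G p) ≠ 0) :
    MvPolynomial.eval p G ≠ 0 ∨ - MvPolynomial.eval p F ≠ 0 := by
  by_contra! hc
  apply hp
  rw [neg_eq_zero] at hc
  rw [cross_W hF hG, gr_Phi, hc.1, hc.2]; simp

lemma notShape_fP {d k' : ℕ} (e : Fin k' → ℕ) (r : ℕ) (hc : k' + r + 3 ≤ d) :
    ∃ ρ : MvPolynomial (Mon d ⊕ Mon d) ℂ, ρ ≠ 0 ∧ ∀ x, MvPolynomial.eval x ρ ≠ 0 →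
      ∀ s : ℂ, crossProduct (pt s) (Wv (FF x) (GG x) (pt s)) ≠ 0 →
        ¬ Shape e r (fP (FF x) (GG x) (pt s)) := by
  obtain ⟨ρ, h1, h2⟩ := notShape (d := d) e r hc
  refine ⟨ρ, h1, fun x hx s hs => ?_⟩
  unfold fP
  rw [Phi_eq]
  exact h2 x hx s _ _ _ (not_base_of_cross (formOf_hom _) (formOf_hom _) _ hs)
    (crossProduct_ne_zero_iff_linearIndependent.1 hs)

lemma notShape_fP_weak {d k' : ℕ} (e : Fin k' → ℕ) (r : ℕ) (hc : k' + r + 2 ≤ d) :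
    ∃ ρ : MvPolynomial (Mon d ⊕ Mon d) ℂ, ρ ≠ 0 ∧ ∀ x, MvPolynomial.eval x ρ ≠ 0 →
      ∀ s : ℂ, crossProduct (pt s) (Wv (FF x) (GG x) (pt s)) ≠ 0 →
        (MvPolynomial.eval (pt s) (GG x) = 0 ∨ Wv (FF x) (GG x) (pt s) 2 = 0) →
        ¬ Shape e r (fP (FF x) (GG x) (pt s)) := by
  obtain ⟨ρ, h1, h2⟩ := notShape_weak (d := d) e r hc
  refine ⟨ρ, h1, fun x hx s hs hor => ?_⟩
  unfold fP
  rw [Phi_eq]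
  exact h2 x hx s _ _ _ (not_base_of_cross (formOf_hom _) (formOf_hom _) _ hs)
    (crossProduct_ne_zero_iff_linearIndependent.1 hs) hor

/-! ### non-singularity -/
section nonsing
variable (k : ℕ)

def m1 : Mon (k + 3) := mk3 (k + 3) 0 0 (by omega)
def m2 : Mon (k + 3) := mk3 (k + 2) 1 0 (by omega)
def m3 : Mon (k + 3) := mk3 (k + 2) 0 1 (by omega)

lemma m12 : m1 k ≠ m2 k := by
  intro h
  have := congrArg (fun m : Mon (k + 3) => m.1 1) h
  simp [m1, m2, mk3] at this
lemma m13 : m1 k ≠ m3 k := by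
  intro h
  have := congrArg (fun m : Mon (k + 3) => m.1 2) h
  simp [m1, m3, mk3] at this
lemma m23 : m2 k ≠ m3 k := by
  intro h
  have := congrArg (fun m : Mon (k + 3) => m.1 2) h
  simp [m2, m3, mk3] at this

open Classical in
def S7 : Finset (Mon (k + 3)) := {m1 k, m2 k, m3 k}

lemma card_S7 : (S7 k).card = 3 := by
  classical
  rw [Finset.card_eq_three]
  exact ⟨_, _, _, m12 k, m13 k, m23 k, rfl⟩

open Classical in
def Y7 (m : Mon (k + 3)) (z : (Fin 1 ⊕ Mon (k + 3)) → ℂ) : ℂ :=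
  if m = m1 k then
    z (Sum.inl 0) * MvPolynomial.eval (fun i => ![1, z (Sum.inl 0), 0] i)
        (MvPolynomial.pderiv 1 (formOf (fun m => z (Sum.inr m)))) -
      MvPolynomial.eval (fun i => ![1, z (Sum.inl 0), 0] i) (formOf (fun m => z (Sum.inr m)))
  else if m = m2 k then
    0 - MvPolynomial.eval (fun i => ![1, z (Sum.inl 0), 0] i)
        (MvPolynomial.pderiv 1 (formOf (fun m => z (Sum.inr m))))
  else 0 - MvPolynomial.eval (fun i => ![1, z (Sum.inl 0), 0] i)
        (MvPolynomial.pderiv 2 (formOf (fun m => z (Sum.inr m))))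

lemma PF_Y7 (m : Mon (k + 3)) : PF (Y7 k m) := by
  have hv : ∀ i : Fin 3, PF (fun z : (Fin 1 ⊕ Mon (k + 3)) → ℂ =>
    (![1, z (Sum.inl 0), 0] : Fin 3 → ℂ) i) := PF.vec3 (PF.const _) (PF.var _) (PF.const _)
  have hf : PM (fun z : (Fin 1 ⊕ Mon (k + 3)) → ℂ => formOf (fun m => z (Sum.inr m))) :=
    PM.formOf fun m => PF.var _
  unfold Y7
  refine PF.ite _ ?_ (PF.ite _ ?_ ?_)
  · exact PF.sub ((PF.var _).mul (PM.eval (PM.pderiv hf _) hv)) (PM.eval hf hv)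
  · exact PF.sub (PF.const _) (PM.eval (PM.pderiv hf _) hv)
  · exact PF.sub (PF.const _) (PM.eval (PM.pderiv hf _) hv)

lemma form_mk3 {d : ℕ} (i j l : ℕ) (h : i + j + l = d) (a : ℂ) :
    (MvPolynomial.monomial (mk3 i j l h).1 a : Form) =
      MvPolynomial.C a * MvPolynomial.X 0 ^ i * MvPolynomial.X 1 ^ j * MvPolynomial.X 2 ^ l := by
  rw [MvPolynomial.monomial_eq, Finsupp.prod_fintype _ _ (by simp), Fin.prod_univ_three]
  simp [mk3, mul_assoc]

lemma form_S7 (b : Mon (k + 3) → ℂ) (hb : ∀ j, j ∉ S7 k → b j = 0) :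
    formOf b = MvPolynomial.C (b (m1 k)) * MvPolynomial.X 0 ^ (k + 3) +
      MvPolynomial.C (b (m2 k)) * MvPolynomial.X 0 ^ (k + 2) * MvPolynomial.X 1 +
      MvPolynomial.C (b (m3 k)) * MvPolynomial.X 0 ^ (k + 2) * MvPolynomial.X 2 := by
  classical
  have h : formOf b = ∑ m ∈ S7 k, MvPolynomial.monomial m.1 (b m) := by
    unfold formOf
    symm
    refine Finset.sum_subset (Finset.subset_univ _) fun j _ hj => ?_
    rw [hb j hj, map_zero]
  have h2 : S7 k = {m1 k, m2 k, m3 k} := by unfold S7; congr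
  rw [h, h2, Finset.sum_insert, Finset.sum_insert, Finset.sum_singleton, m1, m2, m3]
  · simp only [form_mk3, pow_zero, pow_one, mul_one]
    ring
  · simp [m23]
  · simp [m12, m13]

lemma bad_7 (b : Mon (k + 3) → ℂ) (s : ℂ) (h : gr (formOf b) (pt s) = 0) :
    BadV (S7 k) (Y7 k) b := by
  refine BadV.intro (fun _ => s) fun b0 hb0 hb1 => ?_
  have h0 : MvPolynomial.eval (pt s) (formOf b) = 0 := by
    have := euler (formOf_hom b) (pt s)
    rw [h, dotProduct_zero] at this
    have hne : ((k + 3 : ℕ) : ℂ) ≠ 0 := by simp; norm_cast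
    have h3 := this.symm
    rw [mul_eq_zero] at h3
    exact h3.resolve_left hne
  have hsplit : formOf b = formOf b0 + formOf (fun j => b j - b0 j) := by
    rw [← formOf_add]
    congr 1
    ext j
    ring
  have hS : ∀ m ∈ S7 k, b m - b0 m = b m := fun m hm => by rw [hb0 m hm, sub_zero]
  have e1 : m1 k ∈ S7 k := by simp [S7]
  have e2 : m2 k ∈ S7 k := by simp [S7]
  have e3 : m3 k ∈ S7 k := by simp [S7]
  rw [form_S7 k (fun j => b j - b0 j) (fun j hj => by rw [hb1 j hj, sub_self])] at hsplit
  rw [hS _ e1, hS _ e2, hS _ e3] at hsplit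
  have g1 := congrFun h 1
  have g2 := congrFun h 2
  unfold gr at g1 g2
  rw [hsplit] at g1 g2 h0
  simp [MvPolynomial.pderiv_X] at g1 g2 h0
  have hpt : (fun i => (![1, s, 0] : Fin 3 → ℂ) i) = pt s := rfl
  have hmem : ∀ m ∈ S7 k, m = m1 k ∨ m = m2 k ∨ m = m3 k := by
    intro m hm; simpa [S7] using hm
  intro m hm
  unfold Y7
  simp only [Sum.elim_inl, Sum.elim_inr]
  rcases hmem m hm with rfl | rfl | rfl
  · rw [if_pos rfl]
    linear_combination h0 - s * g1
  · rw [if_neg (m12 k).symm, if_pos rfl]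
    linear_combination g1
  · rw [if_neg (m13 k).symm, if_neg (m23 k).symm]
    linear_combination g2

open Classical in
lemma no_base : ∃ ρ : MvPolynomial (Mon (k + 3) ⊕ Mon (k + 3)) ℂ, ρ ≠ 0 ∧
    ∀ x, MvPolynomial.eval x ρ ≠ 0 → ∀ s : ℂ,
      MvPolynomial.eval (pt s) (FF x) = 0 → MvPolynomial.eval (pt s) (GG x) = 0 → False := by
  obtain ⟨ρ, h0, h1⟩ := CL (J := Mon (k + 3) ⊕ Mon (k + 3)) (Θ := Fin 1)
    {Sum.inl (m1 k), Sum.inr (m1 k)}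
    (fun j z => Sum.elim
      (fun _ => 0 - MvPolynomial.eval (fun i => ![1, z (Sum.inl 0), 0] i)
        (formOf fun m => z (Sum.inr (Sum.inl m))))
      (fun _ => 0 - MvPolynomial.eval (fun i => ![1, z (Sum.inl 0), 0] i)
        (formOf fun m => z (Sum.inr (Sum.inr m)))) j) (by
      rintro (m | m)
      · exact PF.sub (PF.const _) (PM.eval (PM.formOf fun m => PF.var _)
          (PF.vec3 (PF.const _) (PF.var _) (PF.const _)))
      · exact PF.sub (PF.const _) (PM.eval (PM.formOf fun m => PF.var _)
          (PF.vec3 (PF.const _) (PF.var _) (PF.const _)))) (by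
      rw [Finset.card_pair (by simp)]; simp)
  refine ⟨ρ, h0, fun x hx s hF hG => hx (h1 x (fun _ => s) ?_)⟩
  have key : ∀ b : Mon (k + 3) → ℂ, MvPolynomial.eval (pt s) (formOf b) = 0 →
      b (m1 k) = 0 - MvPolynomial.eval (pt s) (formOf fun m => if m = m1 k then 0 else b m) := by
    intro b hb
    have hsplit : formOf b = formOf (fun m => if m = m1 k then 0 else b m) +
        formOf (fun m => if m = m1 k then b m else 0) := by
      rw [← formOf_add]
      congr 1
      ext j
      split_ifs <;> simp
    rw [form_S7 k (fun m => if m = m1 k then b m else 0) (by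
      intro j hj
      rw [if_neg]
      rintro rfl
      exact hj (by simp [S7]))] at hsplit
    rw [hsplit] at hb
    simp [(m12 k).symm, (m13 k).symm] at hb
    linear_combination hb
  intro j hj
  simp only [Finset.mem_insert, Finset.mem_singleton] at hj
  rcases hj with rfl | rfl
  · simp only [Sum.elim_inl, Sum.elim_inr]
    simpa using key _ hF
  · simp only [Sum.elim_inl, Sum.elim_inr]
    simpa using key _ hG

lemma nonsing : ∃ ρ : MvPolynomial (Mon (k + 3) ⊕ Mon (k + 3)) ℂ, ρ ≠ 0 ∧
    ∀ x, MvPolynomial.eval x ρ ≠ 0 → ∀ s : ℂ,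
      crossProduct (pt s) (Wv (FF x) (GG x) (pt s)) ≠ 0 := by
  obtain ⟨ρ1, h1, k1⟩ := CL1 (S7 k) (Y7 k) (PF_Y7 k) (by rw [card_S7]; simp)
  obtain ⟨ρ2, h2, k2⟩ := CL2 (S7 k) (Y7 k) (PF_Y7 k) (by rw [card_S7]; simp)
  obtain ⟨ρ3, h3, k3⟩ := no_base k
  refine ⟨ρ1 * ρ2 * ρ3, mul_ne_zero (mul_ne_zero h1 h2) h3, fun x hx s hs => ?_⟩
  simp only [map_mul, ne_eq, mul_eq_zero, not_or] at hx
  obtain ⟨⟨g1, g2⟩, g3⟩ := hx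
  rw [cross_W (formOf_hom _) (formOf_hom _)] at hs
  have hne : ((k + 3 : ℕ) : ℂ) ≠ 0 := by simp; norm_cast
  have hs' := (smul_eq_zero.1 hs).resolve_left hne
  rw [gr_Phi] at hs'
  by_cases hG : MvPolynomial.eval (pt s) (GG x) = 0
  · by_cases hF : MvPolynomial.eval (pt s) (FF x) = 0
    · exact k3 x g3 s hF hG
    · rw [hG, zero_smul, zero_sub, neg_eq_zero] at hs'
      exact k2 x g2 (bad_7 k _ s ((smul_eq_zero.1 hs').resolve_left hF))
  · refine k1 x g1 (-(MvPolynomial.eval (pt s) (FF x) / MvPolynomial.eval (pt s) (GG x)))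
      (bad_7 k _ s ?_)
    rw [formOf_add, formOf_smul, gr_add, gr_smul]
    have := congrArg (fun v => (MvPolynomial.eval (pt s) (GG x))⁻¹ • v) hs'
    simp only [smul_sub, smul_smul, inv_mul_cancel₀ hG, one_smul, smul_zero] at this
    rw [← this, neg_smul, sub_eq_add_neg, div_eq_inv_mul]
end nonsing

end

section

open Polynomial

lemma nS {d k' : ℕ} (e : Fin k' → ℕ) (r : ℕ) :
    ∃ ρ : MvPolynomial (Mon d ⊕ Mon d) ℂ, ρ ≠ 0 ∧ ∀ x, MvPolynomial.eval x ρ ≠ 0 →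
      ∀ s : ℂ, crossProduct (pt s) (Wv (FF x) (GG x) (pt s)) ≠ 0 → k' + r + 3 ≤ d →
        ¬ Shape e r (fP (FF x) (GG x) (pt s)) := by
  by_cases hc : k' + r + 3 ≤ d
  · obtain ⟨ρ, h1, h2⟩ := notShape_fP (d := d) e r hc
    exact ⟨ρ, h1, fun x hx s hs _ => h2 x hx s hs⟩
  · exact ⟨1, one_ne_zero, fun x hx s hs h => (hc h).elim⟩

/-- the genericity conditions -/
structure Gen (k : ℕ) (x : Mon (k + 3) ⊕ Mon (k + 3) → ℂ) : Prop where
  ns : ∀ s : ℂ, crossProduct (pt s) (Wv (FF x) (GG x) (pt s)) ≠ 0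
  co : ∀ s : ℂ, (fP (FF x) (GG x) (pt s)).coeff (k + 1) ≠ 0 ∨
    (fP (FF x) (GG x) (pt s)).coeff k ≠ 0
  top : ∀ s y : ℂ, (X - C y) ^ 2 ∣ fP (FF x) (GG x) (pt s) →
    (fP (FF x) (GG x) (pt s)).coeff (k + 1) ≠ 0
  gam : ∀ s y : ℂ, (X - C y) ^ 2 ∣ fP (FF x) (GG x) (pt s) →
    MvPolynomial.eval (pt s) (GG x) ≠ 0 ∧ Wv (FF x) (GG x) (pt s) 2 ≠ 0
  trp : ∀ s y : ℂ, ¬ (X - C y) ^ 3 ∣ fP (FF x) (GG x) (pt s)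
  bi : ∀ s y z : ℂ, y ≠ z → (X - C y) ^ 2 ∣ fP (FF x) (GG x) (pt s) →
    ¬ (X - C z) ^ 2 ∣ fP (FF x) (GG x) (pt s)

lemma deg_quot {f g q : ℂ[X]} {n e : ℕ} (hf0 : f ≠ 0) (hf : f.natDegree ≤ n) (hg : g.Monic)
    (hge : g.natDegree = e) (h : f = g * q) : e ≤ n ∧ q.degree < ((n - e + 1 : ℕ) : ℕ) := by
  have hq : q ≠ 0 := by rintro rfl; simp at h; exact hf0 h
  have : f.natDegree = e + q.natDegree := by
    rw [h, natDegree_mul hg.ne_zero hq, hge]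
  refine ⟨by omega, ?_⟩
  rw [← natDegree_lt_iff_degree_lt hq]
  omega

lemma exists_gen (k : ℕ) : ∃ ρ : MvPolynomial (Mon (k + 3) ⊕ Mon (k + 3)) ℂ, ρ ≠ 0 ∧
    ∀ x, MvPolynomial.eval x ρ ≠ 0 → Gen k x := by
  obtain ⟨ρ0, h0, k0⟩ := nonsing k
  obtain ⟨ρ1, h1, k1⟩ := nS (d := k + 3) (k' := 0) Fin.elim0 k
  obtain ⟨ρ2, h2, k2⟩ := nS (d := k + 3) (k' := 1) (fun _ => 2) (k - 1)
  obtain ⟨ρ3, h3, k3⟩ := notShape_fP_weak (d := k + 3) (k' := 1) (fun _ => 2) k (by omega)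
  obtain ⟨ρ4, h4, k4⟩ := nS (d := k + 3) (k' := 1) (fun _ => 3) (k - 1)
  obtain ⟨ρ5, h5, k5⟩ := nS (d := k + 3) (k' := 2) (fun _ => 2) (k - 2)
  refine ⟨ρ0 * ρ1 * ρ2 * ρ3 * ρ4 * ρ5, by simp [*], fun x hx => ?_⟩
  simp only [map_mul, ne_eq, mul_eq_zero, not_or] at hx
  obtain ⟨⟨⟨⟨⟨g0, g1⟩, g2⟩, g3⟩, g4⟩, g5⟩ := hx
  have ns := k0 x g0
  have deg : ∀ s, (fP (FF x) (GG x) (pt s)).natDegree ≤ k + 1 := fun s =>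
    natDegree_fP_le (by omega) (formOf_hom _) (formOf_hom _) _
  have co : ∀ s : ℂ, (fP (FF x) (GG x) (pt s)).coeff (k + 1) ≠ 0 ∨
    (fP (FF x) (GG x) (pt s)).coeff k ≠ 0 := by
    intro s
    by_contra! hc
    refine k1 x g1 s (ns s) (by omega) ⟨Fin.elim0, fP (FF x) (GG x) (pt s), ?_, by simp⟩
    rw [degree_lt_iff_coeff_zero]
    intro m hm
    have : m = k ∨ m = k + 1 ∨ k + 1 < m := by omega
    rcases this with rfl | rfl | h
    · exact hc.2
    · exact hc.1
    · exact coeff_eq_zero_of_natDegree_lt ((deg s).trans_lt h)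
  have hne : ∀ s, fP (FF x) (GG x) (pt s) ≠ 0 := by
    intro s h
    have := co s
    simp [h] at this
  have mo : ∀ (y : ℂ) (e : ℕ), ((X - C y) ^ e).Monic := fun y e => (monic_X_sub_C y).pow e
  have nd : ∀ (y : ℂ) (e : ℕ), ((X - C y) ^ e).natDegree = e := fun y e => by simp
  refine ⟨ns, co, ?_, ?_, ?_, ?_⟩
  · rintro s y ⟨q, hq⟩ hc
    have hdeg : (fP (FF x) (GG x) (pt s)).natDegree ≤ k := by
      rw [natDegree_le_iff_coeff_eq_zero]
      intro m hm
      have : m = k + 1 ∨ k + 1 < m := by omega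
      rcases this with rfl | h
      · exact hc
      · exact coeff_eq_zero_of_natDegree_lt ((deg s).trans_lt h)
    obtain ⟨e1, e2⟩ := deg_quot (hne s) hdeg (mo y 2) (nd y 2) hq
    refine k2 x g2 s (ns s) (by omega) ⟨fun _ => y, q, ?_, by simpa using hq⟩
    rwa [show k - 1 = k - 2 + 1 by omega]
  · rintro s y ⟨q, hq⟩
    by_contra hc
    obtain ⟨e1, e2⟩ := deg_quot (hne s) (deg s) (mo y 2) (nd y 2) hq
    rw [not_and_or, not_ne_iff, not_ne_iff] at hc
    refine k3 x g3 s (ns s) hc ⟨fun _ => y, q, ?_, by simpa using hq⟩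
    rwa [show k + 1 - 2 + 1 = k by omega] at e2
  · rintro s y ⟨q, hq⟩
    obtain ⟨e1, e2⟩ := deg_quot (hne s) (deg s) (mo y 3) (nd y 3) hq
    refine k4 x g4 s (ns s) (by omega) ⟨fun _ => y, q, ?_, by simpa using hq⟩
    rwa [show k + 1 - 3 + 1 = k - 1 by omega] at e2
  · rintro s y z hyz hy hz
    have hco : IsCoprime ((X - C y) ^ 2) ((X - C z) ^ 2) :=
      (isCoprime_X_sub_C_of_isUnit_sub (by simpa [sub_eq_zero] using hyz)).pow
    obtain ⟨q, hq⟩ := hco.mul_dvd hy hz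
    obtain ⟨e1, e2⟩ := deg_quot (e := 4) (hne s) (deg s) ((mo y 2).mul (mo z 2)) (by
      rw [natDegree_mul (mo y 2).ne_zero (mo z 2).ne_zero, nd, nd]) hq
    refine k5 x g5 s (ns s) (by omega) ⟨![y, z], q, ?_, by simpa [Fin.prod_univ_two] using hq⟩
    rwa [show k + 1 - 4 + 1 = k - 2 by omega] at e2

end

section

open Polynomial

lemma PF.gr {I : Type*} {f : (I → ℂ) → Form} (hf : PM f) {p : Fin 3 → (I → ℂ) → ℂ}
    (hp : ∀ i, PF (p i)) (i : Fin 3) : PF (fun x => _root_.gr (f x) (fun i => p i x) i) :=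
  PM.eval (PM.pderiv hf i) hp

lemma PF.Wv {I : Type*} {f g : (I → ℂ) → Form} (hf : PM f) (hg : PM g) {p : Fin 3 → (I → ℂ) → ℂ}
    (hp : ∀ i, PF (p i)) (i : Fin 3) : PF (fun x => _root_.Wv (f x) (g x) (fun i => p i x) i) := by
  have h1 := PF.gr hf hp
  have h2 := PF.gr hg hp
  unfold _root_.Wv
  simp only [cross_apply]
  fin_cases i
  · exact ((h1 1).mul (h2 2)).sub ((h1 2).mul (h2 1))
  · exact ((h1 2).mul (h2 0)).sub ((h1 0).mul (h2 2))
  · exact ((h1 0).mul (h2 1)).sub ((h1 1).mul (h2 0))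

lemma PP.fP {I : Type*} {f g : (I → ℂ) → Form} (hf : PM f) (hg : PM g) {p : Fin 3 → (I → ℂ) → ℂ}
    (hp : ∀ i, PF (p i)) : PP (fun x => _root_.fP (f x) (g x) (fun i => p i x)) := by
  unfold _root_.fP
  have hW := PF.Wv hf hg hp
  have hP : PM (fun x => Phi (f x) (g x) (fun i => p i x)) := by
    have : (fun x => Phi (f x) (g x) (fun i => p i x)) = fun x =>
        MvPolynomial.C (MvPolynomial.eval (fun i => p i x) (g x)) * f x +
        MvPolynomial.C ((-1) * MvPolynomial.eval (fun i => p i x) (f x)) * g x := by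
      ext1 x
      simp [Phi, sub_eq_add_neg]
    rw [this]
    exact ((PM.C (PM.eval hg hp)).mul hf).add ((PM.C ((PF.const _).mul (PM.eval hf hp))).mul hg)
  exact PM.lp hP hW hp

/-- univariate version of a polynomial function with a distinguished variable -/
lemma toU {J : Type*} {f : (Option J → ℂ) → ℂ} (hf : PF f) :
    ∃ D : (MvPolynomial J ℂ)[X], ∀ x s, MvPolynomial.eval x (D.eval (MvPolynomial.C s)) =
      f (fun o => o.elim s x) := by
  obtain ⟨P, hP⟩ := hf
  refine ⟨MvPolynomial.aeval (fun o : Option J => o.elim X (fun j => C (MvPolynomial.X j))) P,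
    fun x s => ?_⟩
  rw [hP]
  have : ((MvPolynomial.eval x).comp (evalRingHom (MvPolynomial.C s))).comp
      (MvPolynomial.aeval (R := ℂ)
        (fun o : Option J => o.elim (X : (MvPolynomial J ℂ)[X]) (fun j => C (MvPolynomial.X j)))).toRingHom =
      MvPolynomial.eval (fun o : Option J => o.elim s x) := by
    apply MvPolynomial.ringHom_ext
    · intro r
      have h1 : (algebraMap ℂ (MvPolynomial J ℂ)[X]) r = C (MvPolynomial.C r) := rfl
      simp [h1]
    · intro o
      cases o <;> simp
  exact congrArg (fun φ => φ P) this

lemma toU1 {f : (Unit → ℂ) → ℂ} (hf : PF f) : ∃ D : ℂ[X], ∀ s, D.eval s = f (fun _ => s) := by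
  obtain ⟨P, hP⟩ := hf
  refine ⟨MvPolynomial.aeval (fun _ => X) P, fun s => ?_⟩
  rw [hP]
  have : (evalRingHom s).comp (MvPolynomial.aeval (R := ℂ) (fun _ : Unit => (X : ℂ[X]))).toRingHom =
      MvPolynomial.eval (fun _ : Unit => s) := by
    apply MvPolynomial.ringHom_ext
    · intro r; simp
    · intro o; simp
  exact congrArg (fun φ => φ P) this

/-- restriction to a line in parameter space -/
def lineHom {J : Type*} (x e : J → ℂ) : MvPolynomial J ℂ →+* ℂ[X] :=
  (MvPolynomial.aeval (R := ℂ) (fun j => C (x j) + X * C (e j))).toRingHom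

lemma eval_lineHom {J : Type*} (x e : J → ℂ) (P : MvPolynomial J ℂ) (t : ℂ) :
    (lineHom x e P).eval t = MvPolynomial.eval (fun j => x j + t * e j) P := by
  have : (evalRingHom t).comp (lineHom x e) = MvPolynomial.eval (fun j => x j + t * e j) := by
    apply MvPolynomial.ringHom_ext
    · intro r; simp [lineHom]
    · intro o
      simp [lineHom]
      ring
  exact congrArg (fun φ => φ P) this

abbrev Jk (k : ℕ) := Mon (k + 3) ⊕ Mon (k + 3)

/-- the discriminant -/
def Dis (k : ℕ) (x : Jk k → ℂ) (s : ℂ) : ℂ := dOf (k + 1) (fP (FF x) (GG x) (pt s))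

lemma exists_DU (k : ℕ) : ∃ D : (MvPolynomial (Jk k) ℂ)[X], ∀ x s,
    MvPolynomial.eval x (D.eval (MvPolynomial.C s)) = Dis k x s := by
  have : PF (fun z : Option (Jk k) → ℂ => Dis k (fun j => z (some j)) (z none)) := by
    unfold Dis
    refine PP.dOf ?_ _
    exact PP.fP (PM.formOf fun m => PF.var _) (PM.formOf fun m => PF.var _)
      (PF.vec3 (PF.const _) (PF.var _) (PF.const _))
  obtain ⟨D, hD⟩ := toU this
  exact ⟨D, fun x s => hD x s⟩

/-! ### perturbation -/
open Classical in
def pert (k : ℕ) : Jk k → ℂ := fun j => if j = Sum.inl (mk3 0 0 (k + 3) (by omega)) then 1 else 0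

lemma FF_pert (k : ℕ) (x : Jk k → ℂ) (t : ℂ) : FF (fun j => x j + t * pert k j) =
    FF x + MvPolynomial.C t * MvPolynomial.X 2 ^ (k + 3) := by
  classical
  unfold FF
  rw [formOf_add, formOf_smul, MvPolynomial.smul_eq_C_mul]
  congr 2
  unfold formOf
  rw [Finset.sum_eq_single (mk3 0 0 (k + 3) (by omega))]
  · rw [form_mk3]
    simp [pert]
  · intro m _ hm
    simp [pert, hm]
  · simp

lemma GG_pert (k : ℕ) (x : Jk k → ℂ) (t : ℂ) : GG (fun j => x j + t * pert k j) = GG x := by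
  unfold GG
  congr 1
  ext j
  simp [pert]

lemma fP_pert (k : ℕ) (F G : Form) (s t : ℂ) :
    fP (F + MvPolynomial.C t * MvPolynomial.X 2 ^ (k + 3)) G (pt s) = fP F G (pt s) +
      C (t * (MvPolynomial.eval (pt s) G * (Wv F G (pt s) 2) ^ (k + 3))) := by
  have hg : gr (F + MvPolynomial.C t * MvPolynomial.X 2 ^ (k + 3)) (pt s) = gr F (pt s) := by
    rw [gr_add, gr_C_mul]
    ext i
    simp [gr, Derivation.leibniz_pow]
  have hW : Wv (F + MvPolynomial.C t * MvPolynomial.X 2 ^ (k + 3)) G (pt s) = Wv F G (pt s) := by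
    unfold Wv; rw [hg]
  unfold fP
  rw [hW]
  have hP : Phi (F + MvPolynomial.C t * MvPolynomial.X 2 ^ (k + 3)) G (pt s) = Phi F G (pt s) +
      MvPolynomial.C (t * MvPolynomial.eval (pt s) G) * MvPolynomial.X 2 ^ (k + 3) := by
    unfold Phi
    simp
    ring
  rw [hP, linePoly_add, linePoly_C_mul]
  congr 1
  simp [linePoly]
  ring

lemma Dis_pert (k : ℕ) (hk : 1 ≤ k) (x : Jk k → ℂ) (s t : ℂ)
    (hc : (fP (FF x) (GG x) (pt s)).coeff (k + 1) ≠ 0) :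
    Dis k (fun j => x j + t * pert k j) s =
      (((k + 1 : ℕ) : ℂ) * (fP (FF x) (GG x) (pt s)).coeff (k + 1)) ^ k *
      ((derivative (fP (FF x) (GG x) (pt s))).roots.map fun y => ((k + 1 : ℕ) : ℂ) *
        ((fP (FF x) (GG x) (pt s)).eval y +
        t * (MvPolynomial.eval (pt s) (GG x) * (Wv (FF x) (GG x) (pt s) 2) ^ (k + 3)))).prod := by
  unfold Dis
  rw [FF_pert, GG_pert, fP_pert]
  have hdeg : (fP (FF x) (GG x) (pt s)).natDegree ≤ k + 1 :=
    natDegree_fP_le (by omega) (formOf_hom _) (formOf_hom _) _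
  set f := fP (FF x) (GG x) (pt s)
  set γ := MvPolynomial.eval (pt s) (GG x) * (Wv (FF x) (GG x) (pt s) 2) ^ (k + 3)
  have h1 : (f + C (t * γ)).coeff (k + 1) = f.coeff (k + 1) := by
    rw [coeff_add, coeff_C, if_neg (by omega), add_zero]
  rw [dOf_eq_prod (n := k + 1) (by omega) (by
    refine (natDegree_add_le _ _).trans ?_
    rw [natDegree_C]
    simpa using hdeg) (by rw [h1]; exact hc), h1]
  simp

end

section

open Polynomial

lemma X_sq_dvd_cancel {A B : ℂ[X]} (h : X ^ 2 ∣ A * B) (hA : A.eval 0 ≠ 0) : X ^ 2 ∣ B := by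
  have : IsCoprime (X ^ 2 : ℂ[X]) A := by
    apply IsCoprime.pow_left
    rw [(irreducible_X (R := ℂ)).coprime_iff_not_dvd, X_dvd_iff, coeff_zero_eq_eval_zero]
    exact hA
  exact this.dvd_of_dvd_mul_left h

lemma two_roots (M : Multiset ℂ) (n γ : ℂ) (hn : n ≠ 0) (hγ : γ ≠ 0) (g : ℂ → ℂ)
    (h : (X : ℂ[X]) ^ 2 ∣ (M.map fun y => C n * (C (g y) + X * C γ)).prod) :
    ∃ y z, ({y, z} : Multiset ℂ) ≤ M ∧ g y = 0 ∧ g z = 0 := by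
  have key : ∀ M : Multiset ℂ, (X : ℂ[X]) ∣ (M.map fun y => C n * (C (g y) + X * C γ)).prod →
      ∃ y ∈ M, g y = 0 := by
    intro M hM
    obtain ⟨a, ha, hX⟩ := Prime.exists_mem_multiset_dvd prime_X hM
    obtain ⟨y, hy, rfl⟩ := Multiset.mem_map.1 ha
    refine ⟨y, hy, ?_⟩
    rw [X_dvd_iff] at hX
    simpa [hn] using hX
  obtain ⟨y, hy, hgy⟩ := key M (dvd_trans (dvd_pow_self X two_ne_zero) h)
  obtain ⟨M', rfl⟩ := Multiset.exists_cons_of_mem hy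
  rw [Multiset.map_cons, Multiset.prod_cons, hgy, C_0, zero_add,
    show C n * (X * C γ) = X * (C (n * γ) : ℂ[X]) by rw [C_mul]; ring, mul_assoc, pow_two] at h
  have h2 := (mul_dvd_mul_iff_left X_ne_zero).1 h
  have h3 : (X : ℂ[X]) ∣ (M'.map fun y => C n * (C (g y) + X * C γ)).prod := by
    rcases prime_X.dvd_or_dvd h2 with h4 | h4
    · rw [X_dvd_iff] at h4
      simp [hn, hγ] at h4
    · exact h4
  obtain ⟨z, hz, hgz⟩ := key M' h3
  refine ⟨y, z, ?_, hgy, hgz⟩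
  rw [Multiset.insert_eq_cons, Multiset.cons_le_cons_iff, Multiset.singleton_le]
  exact hz

lemma pert_contra (k : ℕ) (hk : 1 ≤ k) (x : Jk k → ℂ) (hx : Gen k x) (s : ℂ)
    {q D E1 C1 : MvPolynomial (Jk k) ℂ} (hD : ∀ x, MvPolynomial.eval x D = Dis k x s)
    (h : q * D = E1 * E1 * C1) (hq : MvPolynomial.eval x q ≠ 0)
    (hE : MvPolynomial.eval x E1 = 0) : False := by
  set f := fP (FF x) (GG x) (pt s) with hf
  have hdeg : f.natDegree ≤ k + 1 :=
    natDegree_fP_le (by omega) (formOf_hom _) (formOf_hom _) _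
  have hD0 : dOf (k + 1) f = 0 := by
    have h1 := congrArg (MvPolynomial.eval x) h
    simp only [map_mul, hE, zero_mul, mul_eq_zero, hq, false_or, hD] at h1
    exact h1
  obtain ⟨y0, hy0⟩ := (dOf_eq_zero_iff (by omega) hdeg (hx.co s)).1 hD0
  have hc := hx.top s y0 hy0
  obtain ⟨hG, hW⟩ := hx.gam s y0 hy0
  set γ := MvPolynomial.eval (pt s) (GG x) * (Wv (FF x) (GG x) (pt s) 2) ^ (k + 3) with hγ
  have hγ0 : γ ≠ 0 := mul_ne_zero hG (pow_ne_zero _ hW)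
  have hn0 : ((k + 1 : ℕ) : ℂ) ≠ 0 := by norm_cast
  have hφ := congrArg (lineHom x (pert k)) h
  simp only [map_mul] at hφ
  have ev0 : ∀ P, (lineHom x (pert k) P).eval 0 = MvPolynomial.eval x P := by
    intro P; rw [eval_lineHom]; simp
  have hXE : X ∣ lineHom x (pert k) E1 := by
    rw [X_dvd_iff, coeff_zero_eq_eval_zero, ev0, hE]
  have h2 : X ^ 2 ∣ lineHom x (pert k) D := by
    refine X_sq_dvd_cancel (A := lineHom x (pert k) q) ?_ (by rw [ev0]; exact hq)
    rw [hφ, pow_two]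
    exact dvd_mul_of_dvd_left (mul_dvd_mul hXE hXE) _
  have h3 : lineHom x (pert k) D = C ((((k + 1 : ℕ) : ℂ) * f.coeff (k + 1)) ^ k) *
      ((derivative f).roots.map fun y => C ((k + 1 : ℕ) : ℂ) *
        (C (f.eval y) + X * C γ)).prod := by
    apply Polynomial.funext
    intro t
    rw [eval_lineHom, hD, Dis_pert k hk x s t hc, eval_mul, eval_C, eval_multiset_prod,
      Multiset.map_map]
    congr 2
    refine Multiset.map_congr rfl fun y _ => ?_
    simp [hf, hγ]
  rw [h3] at h2
  have h4 := X_sq_dvd_cancel h2 (by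
    rw [eval_C]; exact pow_ne_zero _ (mul_ne_zero hn0 hc))
  obtain ⟨y, z, hyz, hy, hz⟩ := two_roots _ _ γ hn0 hγ0 (fun y => f.eval y) h4
  have hmem : ∀ w ∈ (derivative f).roots, f.eval w = 0 → (X - C w) ^ 2 ∣ f := by
    intro w hw h0
    rw [sq_dvd_iff]
    exact ⟨h0, (mem_roots'.1 hw).2⟩
  by_cases hne : y = z
  · subst hne
    apply hx.trp s y
    have hf0 : f ≠ 0 := by
      intro h0
      apply hc
      rw [← hf, h0, coeff_zero]
    rw [← le_rootMultiplicity_iff hf0]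
    have h5 := derivative_rootMultiplicity_of_root (p := f) (t := y) hy
    rw [← count_roots] at h5
    have h6 := Multiset.le_iff_count.1 hyz y
    simp at h6
    rw [← count_roots] at h6
    omega
  · exact hx.bi s y z hne
      (hmem y (Multiset.mem_of_le hyz (by simp)) hy) (hmem z (Multiset.mem_of_le hyz (by simp)) hz)

end

section

open Polynomial

lemma clear_denoms {R : Type} [CommRing R] [IsDomain R] (p : (FractionRing R)[X]) :
    ∃ (b : R) (P : R[X]), b ≠ 0 ∧ P.map (algebraMap R (FractionRing R)) =
      C (algebraMap R (FractionRing R) b) * p := by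
  obtain ⟨b, hb, h⟩ := IsLocalization.integerNormalization_spec (nonZeroDivisors R) p
  refine ⟨b, IsLocalization.integerNormalization (nonZeroDivisors R) p, nonZeroDivisors.ne_zero hb, ?_⟩
  rw [h, ← smul_eq_C_mul, algebraMap_smul]

lemma sep_dichotomy {R : Type} [CommRing R] [IsDomain R] [CharZero R] (D : R[X]) (hD : D ≠ 0) :
    (∃ (c : R) (A B : R[X]), c ≠ 0 ∧ A * D + B * derivative D = C c) ∨
    (∃ (c : R) (E C1 : R[X]), c ≠ 0 ∧ 0 < E.natDegree ∧ C c * D = E * E * C1) := by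
  set K := FractionRing R
  set φ := algebraMap R K with hφ
  have hinj : Function.Injective φ := IsFractionRing.injective R K
  have hmi : Function.Injective (Polynomial.map φ) := map_injective _ hinj
  have : CharZero K := charZero_of_injective_algebraMap hinj
  have hDK : D.map φ ≠ 0 := by
    rw [Ne, Polynomial.map_eq_zero_iff hinj]; exact hD
  by_cases hs : (D.map φ).Separable
  · left
    obtain ⟨a, b, hab⟩ := hs
    obtain ⟨α, A, hα, hA⟩ := clear_denoms a
    obtain ⟨β, B, hβ, hB⟩ := clear_denoms b
    refine ⟨α * β, C β * A, C α * B, mul_ne_zero hα hβ, hmi ?_⟩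
    simp only [Polynomial.map_add, Polynomial.map_mul, map_C, ← derivative_map]
    rw [hA, hB]
    rw [← hφ]
    have : C (φ (α * β)) = C (φ α) * C (φ β) * (1 : K[X]) := by simp
    rw [this, ← hab]
    ring
  · right
    rw [PerfectField.separable_iff_squarefree] at hs
    unfold Squarefree at hs
    push Not at hs
    obtain ⟨e, ⟨c', he⟩, hu⟩ := hs
    obtain ⟨α, E, hα, hE⟩ := clear_denoms e
    obtain ⟨β, C1, hβ, hC⟩ := clear_denoms c'
    have he0 : e ≠ 0 := by
      rintro rfl
      apply hDK
      rw [he]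
      simp
    refine ⟨α * α * β, E, C1, mul_ne_zero (mul_ne_zero hα hα) hβ, ?_, hmi ?_⟩
    · rw [← natDegree_map_eq_of_injective hinj, hE, natDegree_C_mul (by
        rw [Ne, map_eq_zero_iff _ hinj]; exact hα)]
      rw [Nat.pos_iff_ne_zero]
      intro h0
      apply hu
      rw [isUnit_iff_degree_eq_zero, degree_eq_natDegree he0, h0]; rfl
    · simp only [Polynomial.map_mul, map_C]
      rw [he, hE, hC, ← hφ]
      simp only [map_mul]
      ring

lemma eval_eval_map {J : Type} (D : (MvPolynomial J ℂ)[X]) (x : J → ℂ) (s : ℂ) :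
    MvPolynomial.eval x (D.eval (MvPolynomial.C s)) = (D.map (MvPolynomial.eval x)).eval s := by
  rw [← eval_map_apply]
  simp

lemma sep_generic (k : ℕ) (D : (MvPolynomial (Jk k) ℂ)[X]) (hD0 : D ≠ 0)
    (hD : ∀ x s, MvPolynomial.eval x (D.eval (MvPolynomial.C s)) = Dis k x s) :
    ∃ q : MvPolynomial (Jk k) ℂ, q ≠ 0 ∧ ∀ x, MvPolynomial.eval x q ≠ 0 →
      (D.map (MvPolynomial.eval x)).Separable := by
  rcases Nat.eq_zero_or_pos k with rfl | hk
  · refine ⟨1, one_ne_zero, fun x _ => ?_⟩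
    have : D.map (MvPolynomial.eval x) = 1 := by
      apply Polynomial.funext
      intro s
      rw [← eval_eval_map, hD, Dis, dOf_one, eval_one]
    rw [this]
    exact separable_one
  rcases sep_dichotomy D hD0 with ⟨c, A, B, hc, h⟩ | ⟨c, E, C1, hc, hE, h⟩
  · refine ⟨c, hc, fun x hx => ?_⟩
    have h1 := congrArg (Polynomial.map (MvPolynomial.eval x)) h
    simp only [Polynomial.map_add, Polynomial.map_mul, map_C, ← derivative_map] at h1
    refine ⟨C (MvPolynomial.eval x c)⁻¹ * A.map (MvPolynomial.eval x),
      C (MvPolynomial.eval x c)⁻¹ * B.map (MvPolynomial.eval x), ?_⟩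
    rw [mul_assoc, mul_assoc, ← mul_add, h1, ← C_mul, inv_mul_cancel₀ hx, C_1]
  · exfalso
    obtain ⟨ρ, hρ, hgen⟩ := exists_gen k
    have hl : E.leadingCoeff ≠ 0 := by
      rw [Ne, leadingCoeff_eq_zero]
      rintro rfl
      simp at hE
    obtain ⟨x, hx⟩ := exists_ne_zero_eval (mul_ne_zero (mul_ne_zero hρ hl) hc)
    simp only [map_mul, ne_eq, mul_eq_zero, not_or] at hx
    obtain ⟨⟨g1, g2⟩, g3⟩ := hx
    have hdeg : (E.map (MvPolynomial.eval x)).natDegree = E.natDegree :=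
      natDegree_map_of_leadingCoeff_ne_zero _ g2
    obtain ⟨s, hs⟩ := IsAlgClosed.exists_root (E.map (MvPolynomial.eval x)) (by
      intro h0
      rw [natDegree_eq_zero_iff_degree_le_zero.2 h0.le] at hdeg
      omega)
    refine pert_contra k hk x (hgen x g1) s (q := c) (D := D.eval (MvPolynomial.C s))
      (E1 := E.eval (MvPolynomial.C s)) (C1 := C1.eval (MvPolynomial.C s)) (fun x => hD x s)
      ?_ g3 ?_
    · have := congrArg (Polynomial.eval (MvPolynomial.C s)) h
      simpa using this
    · rw [eval_eval_map]; exact hs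

end

section

open Polynomial

abbrev pinf : Fin 3 → ℂ := ![0, 1, 0]

def Qinf (k : ℕ) (x : Jk k → ℂ) : ℂ := Wv (FF x) (GG x) pinf 0 *
  (fP (FF x) (GG x) pinf).coeff (k + 1) * dOf (k + 1) (fP (FF x) (GG x) pinf)

lemma PF_Qinf (k : ℕ) : PF (Qinf k) := by
  have hF : PM (fun x : Jk k → ℂ => FF x) := PM.formOf fun m => PF.var _
  have hG : PM (fun x : Jk k → ℂ => GG x) := PM.formOf fun m => PF.var _
  have hp : ∀ i : Fin 3, PF (fun _ : Jk k → ℂ => pinf i) := fun i => PF.const _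
  unfold Qinf
  exact ((PF.Wv hF hG hp 0).mul ((PP.fP hF hG hp).coeff _)).mul ((PP.fP hF hG hp).dOf _)

def F1 (k : ℕ) : Form := MvPolynomial.X 2 * MvPolynomial.X 1 ^ (k + 2) +
  MvPolynomial.X 0 ^ 2 * MvPolynomial.X 1 ^ (k + 1) + MvPolynomial.X 0 ^ (k + 3)
def G1 (k : ℕ) : Form := MvPolynomial.X 1 ^ (k + 3)

lemma F1_hom (k : ℕ) : (F1 k).IsHomogeneous (k + 3) := by
  unfold F1
  have hX : ∀ i : Fin 3, ∀ n, ((MvPolynomial.X i ^ n : Form)).IsHomogeneous n := fun i n =>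
    MvPolynomial.isHomogeneous_X_pow i n
  refine MvPolynomial.IsHomogeneous.add (MvPolynomial.IsHomogeneous.add ?_ ?_) (hX _ _)
  · have := (MvPolynomial.isHomogeneous_X ℂ (2 : Fin 3)).mul (hX 1 (k + 2))
    rwa [show 1 + (k + 2) = k + 3 by omega] at this
  · have := (hX 0 2).mul (hX 1 (k + 1))
    rwa [show 2 + (k + 1) = k + 3 by omega] at this

lemma G1_hom (k : ℕ) : (G1 k).IsHomogeneous (k + 3) := MvPolynomial.isHomogeneous_X_pow _ _

lemma gr_F1 (k : ℕ) : gr (F1 k) pinf = ![0, 0, 1] := by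
  ext i
  fin_cases i <;> simp [gr, F1, Derivation.leibniz_pow, MvPolynomial.pderiv_X]

lemma gr_G1 (k : ℕ) : gr (G1 k) pinf = ![0, (k : ℂ) + 3, 0] := by
  ext i
  fin_cases i <;> simp [gr, G1, Derivation.leibniz_pow, MvPolynomial.pderiv_X]

lemma Wv_1 (k : ℕ) : Wv (F1 k) (G1 k) pinf = ![-((k : ℂ) + 3), 0, 0] := by
  rw [Wv, gr_F1, gr_G1]
  ext i
  fin_cases i <;> simp [cross_apply]

lemma fP_1 (k : ℕ) : fP (F1 k) (G1 k) pinf =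
    C (((k : ℂ) + 3) ^ 2) * X ^ (k + 1) + C ((-((k : ℂ) + 3)) ^ (k + 3)) := by
  unfold fP
  have h : Phi (F1 k) (G1 k) pinf = F1 k := by
    simp [Phi]
    have h1 : MvPolynomial.eval pinf (F1 k) = 0 := by simp [F1]
    have h2 : MvPolynomial.eval pinf (G1 k) = 1 := by simp [G1]
    rw [h1, h2]; simp
  rw [h, Wv_1]
  simp [linePoly, F1]
  ring

lemma no_double (k : ℕ) {a c : ℂ} (y : ℂ) (ha : a ≠ 0) (hc : c ≠ 0) :
    ¬ (X - C y) ^ 2 ∣ C a * X ^ (k + 1) + C c := by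
  intro hy
  rw [sq_dvd_iff] at hy
  have hk1 : (k : ℂ) + 1 ≠ 0 := by norm_cast
  obtain ⟨h1, h2⟩ := hy
  simp [ha, hk1] at h1 h2
  rw [pow_succ, h2.1] at h1
  simp [hc] at h1

lemma Qinf_1 (k : ℕ) : ∃ x, Qinf k x ≠ 0 := by
  refine ⟨Sum.elim (fun m => (F1 k).coeff m.1) (fun m => (G1 k).coeff m.1), ?_⟩
  have e1 : FF (Sum.elim (fun m : Mon (k + 3) => (F1 k).coeff m.1)
    (fun m : Mon (k + 3) => (G1 k).coeff m.1)) = F1 k := formOf_coeff (F1_hom k)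
  have e2 : GG (Sum.elim (fun m : Mon (k + 3) => (F1 k).coeff m.1)
    (fun m : Mon (k + 3) => (G1 k).coeff m.1)) = G1 k := formOf_coeff (G1_hom k)
  have hk : (k : ℂ) + 3 ≠ 0 := by norm_cast
  have hco : (fP (F1 k) (G1 k) pinf).coeff (k + 1) ≠ 0 := by
    rw [fP_1]
    rw [coeff_add, coeff_C_mul, coeff_X_pow_self, coeff_C, if_neg (by omega), mul_one, add_zero]
    exact pow_ne_zero _ hk
  unfold Qinf
  rw [e1, e2]
  refine mul_ne_zero (mul_ne_zero ?_ hco) ?_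
  · rw [Wv_1]
    simp only [Matrix.cons_val_zero, ne_eq, neg_eq_zero]
    exact hk
  · intro h0
    rw [dOf_eq_zero_iff (n := k + 1) (by omega) (natDegree_fP_le (d := k + 3) (by omega) (F1_hom k) (G1_hom k) _)
      (Or.inl hco)] at h0
    obtain ⟨y, hy⟩ := h0
    rw [fP_1] at hy
    exact no_double k y (pow_ne_zero _ hk) (pow_ne_zero _ (neg_ne_zero.2 hk)) hy

lemma cross_inf {k : ℕ} {x : Jk k → ℂ} (h : Qinf k x ≠ 0) :
    crossProduct pinf (Wv (FF x) (GG x) pinf) ≠ 0 := by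
  intro h0
  apply h
  have := congrFun h0 2
  simp [cross_apply] at this
  simp [Qinf, this]

lemma not_bit_inf {k : ℕ} {x : Jk k → ℂ} (h : Qinf k x ≠ 0) : ¬ Bit (FF x) (GG x) pinf := by
  rw [bit_iff (d := k + 3) (by omega) (formOf_hom _) (formOf_hom _) _ (cross_inf h)]
  unfold Qinf at h
  rw [← dOf_eq_zero_iff (n := k + 1) (by omega)
    (natDegree_fP_le (d := k + 3) (by omega) (formOf_hom _) (formOf_hom _) _)
    (Or.inl (right_ne_zero_of_mul (left_ne_zero_of_mul h)))]
  exact right_ne_zero_of_mul h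

lemma degree_D {k : ℕ} {x : Jk k → ℂ} (h : Qinf k x ≠ 0) (D : ℂ[X])
    (hD : ∀ s, D.eval s = Dis k x s) :
    D.natDegree = k * (2 * k ^ 2 + 17 * k + 27) ∧ D ≠ 0 := by
  obtain ⟨R, hR⟩ : ∃ R : ℂ[X], ∀ u, R.eval u = dOf (k + 1) (fP (FF x) (GG x) ![u, 1, 0]) := by
    have : PF (fun z : Unit → ℂ => dOf (k + 1) (fP (FF x) (GG x)
        (fun i => (![z (), 1, 0] : Fin 3 → ℂ) i))) := by
      refine PP.dOf (PP.fP ?_ ?_ (PF.vec3 (PF.var _) (PF.const _) (PF.const _))) _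
      · exact PM.formOf fun m => PF.const _
      · exact PM.formOf fun m => PF.const _
    obtain ⟨R, hR⟩ := toU1 this
    exact ⟨R, hR⟩
  have key := reverse_degree (k * (2 * k ^ 2 + 17 * k + 27)) D R (by
    intro t ht
    rw [hD, hR, ← dOf_fP_smul k (formOf_hom _) (formOf_hom _) _ t ht, Dis]
    congr 2
    ext i
    fin_cases i <;> simp [ht])
  have h1 : D.coeff (k * (2 * k ^ 2 + 17 * k + 27)) ≠ 0 := by
    rw [key.2, hR]
    exact right_ne_zero_of_mul h
  refine ⟨le_antisymm key.1 (le_natDegree_of_ne_zero h1), ?_⟩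
  rintro rfl
  simp at h1

/-- the main count in coordinates -/
lemma count_coord (k : ℕ) : ∃ Q : MvPolynomial (Jk k) ℂ, Q ≠ 0 ∧
    ∀ x, MvPolynomial.eval x Q ≠ 0 →
      ¬ Bit (FF x) (GG x) pinf ∧ {s : ℂ | Bit (FF x) (GG x) (pt s)}.Finite ∧
      {s : ℂ | Bit (FF x) (GG x) (pt s)}.ncard = k * (2 * k ^ 2 + 17 * k + 27) ∧
      Wv (FF x) (GG x) pinf ≠ 0 := by
  obtain ⟨D, hD⟩ := exists_DU k
  have hDx : ∀ x s, (D.map (MvPolynomial.eval x)).eval s = Dis k x s := fun x s => by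
    rw [← eval_eval_map, hD]
  obtain ⟨x0, hx0⟩ := Qinf_1 k
  have hD0 : D ≠ 0 := by
    rintro rfl
    exact (degree_D hx0 _ (hDx x0)).2 (by simp)
  obtain ⟨q, hq, hsep⟩ := sep_generic k D hD0 hD
  obtain ⟨ρ, hρ, hgen⟩ := exists_gen k
  obtain ⟨P, hP⟩ := PF_Qinf k
  have hP0 : P ≠ 0 := by
    rintro rfl
    exact hx0 (by rw [hP, map_zero])
  refine ⟨q * ρ * P, mul_ne_zero (mul_ne_zero hq hρ) hP0, fun x hx => ?_⟩
  simp only [map_mul, ne_eq, mul_eq_zero, not_or] at hx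
  obtain ⟨⟨g1, g2⟩, g3⟩ := hx
  rw [← hP] at g3
  have hg := hgen x g2
  obtain ⟨hdeg, hne⟩ := degree_D g3 _ (hDx x)
  have hset : {s : ℂ | Bit (FF x) (GG x) (pt s)} =
      ((D.map (MvPolynomial.eval x)).roots.toFinset : Set ℂ) := by
    ext s
    rw [Set.mem_ofPred_eq, bit_iff (d := k + 3) (by omega) (formOf_hom _) (formOf_hom _) _ (hg.ns s),
      ← dOf_eq_zero_iff (n := k + 1) (by omega)
      (natDegree_fP_le (d := k + 3) (by omega) (formOf_hom _) (formOf_hom _) _) (hg.co s)]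
    rw [Finset.mem_coe, Multiset.mem_toFinset, mem_roots hne, IsRoot.def, hDx]
    rfl
  refine ⟨not_bit_inf g3, ?_, ?_, ?_⟩
  · rw [hset]; exact Finset.finite_toSet _
  · rw [hset, Set.ncard_coe_finset, Multiset.toFinset_card_of_nodup
      (nodup_roots (hsep x g1)), ← hdeg]
    exact (IsAlgClosed.splits _).natDegree_eq_card_roots.symm
  · intro h0
    apply cross_inf g3
    rw [h0]
    simp

end

section

open Polynomial

/-- substitution moving the line `u = 0` to the line `h` -/
def subV (h : Fin 3 → ℂ) : Fin 3 → Form :=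
  ![MvPolynomial.C (h 2) * MvPolynomial.X 0, MvPolynomial.C (h 2) * MvPolynomial.X 1,
    MvPolynomial.C ((-1) * h 0) * MvPolynomial.X 0 + MvPolynomial.C ((-1) * h 1) * MvPolynomial.X 1 +
      MvPolynomial.X 2]

def subF (h : Fin 3 → ℂ) (F : Form) : Form := MvPolynomial.aeval (subV h) F

def Mh (h : Fin 3 → ℂ) (hh : h 2 ≠ 0) : (Fin 3 → ℂ) ≃ₗ[ℂ] (Fin 3 → ℂ) where
  toFun v := ![h 2 * v 0, h 2 * v 1, - h 0 * v 0 - h 1 * v 1 + v 2]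
  invFun y := ![y 0 / h 2, y 1 / h 2, y 2 + (h 0 * y 0 + h 1 * y 1) / h 2]
  map_add' v w := by
    ext i
    fin_cases i <;> simp <;> ring
  map_smul' c v := by
    ext i
    fin_cases i <;> simp <;> ring
  left_inv v := by
    ext i
    fin_cases i <;> simp <;> field_simp
    ring
  right_inv v := by
    ext i
    fin_cases i <;> simp <;> field_simp
    ring

lemma subF_hom (h : Fin 3 → ℂ) {d : ℕ} {F : Form} (hF : F.IsHomogeneous d) :
    (subF h F).IsHomogeneous d := by
  have h1 : ∀ i, (subV h i).IsHomogeneous 1 := by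
    have hX : ∀ (c : ℂ) (i : Fin 3), (MvPolynomial.C c * MvPolynomial.X i : Form).IsHomogeneous 1 :=
      fun c i => MvPolynomial.IsHomogeneous.C_mul (MvPolynomial.isHomogeneous_X ℂ i) c
    intro i
    fin_cases i
    · exact hX _ _
    · exact hX _ _
    · exact ((hX _ _).add (hX _ _)).add (MvPolynomial.isHomogeneous_X ℂ _)
  have := hF.aeval (subV h) h1
  rwa [one_mul] at this

lemma linePoly_subF (h : Fin 3 → ℂ) (hh : h 2 ≠ 0) (F : Form) (v w : Fin 3 → ℂ) :
    linePoly (subF h F) v w = linePoly F (Mh h hh v) (Mh h hh w) := by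
  unfold linePoly subF
  have : (MvPolynomial.aeval (R := ℂ) (fun i => C (v i) + X * C (w i))).comp
      (MvPolynomial.aeval (subV h)) =
      MvPolynomial.aeval (R := ℂ) (fun i => C (Mh h hh v i) + X * C (Mh h hh w i)) := by
    apply MvPolynomial.algHom_ext
    intro i
    fin_cases i <;> simp [subV, Mh] <;> ring
  exact congrArg (fun φ => φ F) this

lemma subF_lin (h : Fin 3 → ℂ) (l m : ℂ) (F G : Form) :
    subF h (l • F + m • G) = l • subF h F + m • subF h G := by
  simp [subF]

lemma LI_map (e : (Fin 3 → ℂ) ≃ₗ[ℂ] (Fin 3 → ℂ)) (v w : Fin 3 → ℂ) :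
    LinearIndependent ℂ ![e v, e w] ↔ LinearIndependent ℂ ![v, w] := by
  rw [LinearIndependent.pair_iff, LinearIndependent.pair_iff]
  simp only [← map_smul, ← map_add, LinearEquiv.map_eq_zero_iff]

lemma Bit_subF (h : Fin 3 → ℂ) (hh : h 2 ≠ 0) (F G : Form) (v : Fin 3 → ℂ) :
    Bit (subF h F) (subF h G) v ↔ Bit F G (Mh h hh v) := by
  unfold Bit
  simp only [← subF_lin, linePoly_subF h hh]
  constructor
  · rintro ⟨l, m, w, h1, h2, h3⟩
    exact ⟨l, m, Mh h hh w, h1, (LI_map _ _ _).2 h2, h3⟩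
  · rintro ⟨l, m, w, h1, h2, h3⟩
    refine ⟨l, m, (Mh h hh).symm w, h1, ?_, ?_⟩
    · rw [← LI_map (Mh h hh), LinearEquiv.apply_symm_apply]
      exact h2
    · rw [LinearEquiv.apply_symm_apply]
      exact h3

lemma Bit_smul {d : ℕ} {F G : Form} (hF : F.IsHomogeneous d) (hG : G.IsHomogeneous d)
    (v : Fin 3 → ℂ) (c : ℂ) (hc : c ≠ 0) (h : Bit F G v) : Bit F G (c • v) := by
  obtain ⟨l, m, w, h1, h2, h3, h4⟩ := h
  have hH : (l • F + m • G).IsHomogeneous d :=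
    (MvPolynomial.homogeneousSubmodule (Fin 3) ℂ d).add_mem
      (Submodule.smul_mem _ _ hF) (Submodule.smul_mem _ _ hG)
  rw [X_sq_dvd_linePoly] at h3 h4
  refine ⟨l, m, w, h1, ?_, ?_, ?_⟩
  · rw [LinearIndependent.pair_iff] at h2 ⊢
    intro a b hab
    have := h2 (a * c) b (by rw [mul_smul]; exact hab)
    simpa [hc] using this
  · rw [X_sq_dvd_linePoly, eval_hom hH, gr_hom hH, smul_dotProduct, h3.1, h3.2]
    simp
  · rw [X_sq_dvd_linePoly, dotProduct_smul, h4.1, h4.2]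
    simp

lemma Bit_smul_iff {d : ℕ} {F G : Form} (hF : F.IsHomogeneous d) (hG : G.IsHomogeneous d)
    (v : Fin 3 → ℂ) (c : ℂ) (hc : c ≠ 0) : Bit F G (c • v) ↔ Bit F G v := by
  refine ⟨fun h => ?_, Bit_smul hF hG v c hc⟩
  have := Bit_smul hF hG _ c⁻¹ (inv_ne_zero hc) h
  rwa [smul_smul, inv_mul_cancel₀ hc, one_smul] at this

lemma Bit_iff_pencil (F G : Form) (v : Fin 3 → ℂ) : Bit F G v ↔
    ∃ (c : Projectivization ℂ (Fin 2 → ℂ)) (w : Fin 3 → ℂ),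
      LinearIndependent ℂ ![v, w] ∧
      ContactLE (pencilMember F G c) v w 2 ∧ ContactLE (pencilMember F G c) w v 2 := by
  constructor
  · rintro ⟨l, m, w, h1, h2, h3, h4⟩
    have hne : (![l, m] : Fin 2 → ℂ) ≠ 0 := by
      intro h0
      have e0 := congrFun h0 0
      have e1 := congrFun h0 1
      simp at e0 e1
      simp [e0, e1] at h1
    obtain ⟨a, ha⟩ := Projectivization.exists_smul_eq_mk_rep ℂ ![l, m] hne
    refine ⟨Projectivization.mk ℂ ![l, m] hne, w, h2, ?_⟩
    have hp : pencilMember F G (Projectivization.mk ℂ ![l, m] hne) = (a : ℂ) • (l • F + m • G) := by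
      unfold pencilMember
      rw [← ha, smul_add, smul_smul, smul_smul]
      simp [Units.smul_def]
    unfold ContactLE
    rw [hp, linePoly_smul, linePoly_smul]
    exact ⟨dvd_mul_of_dvd_right h3 _, dvd_mul_of_dvd_right h4 _⟩
  · rintro ⟨c, w, h2, h3, h4⟩
    refine ⟨c.rep 0, c.rep 1, w, ?_, h2, h3, h4⟩
    by_contra! hc
    apply c.rep_nonzero
    ext i
    fin_cases i
    · exact hc.1
    · exact hc.2

lemma set_eq {d : ℕ} {F G : Form} (hF : F.IsHomogeneous d) (hG : G.IsHomogeneous d)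
    (h : Fin 3 → ℂ) (hh : h 2 ≠ 0) (hinf : ¬ Bit (subF h F) (subF h G) pinf) :
    (bitangencyPointsOnLine F G h).ncard = {s : ℂ | Bit (subF h F) (subF h G) (pt s)}.ncard ∧
    ({s : ℂ | Bit (subF h F) (subF h G) (pt s)}.Finite → (bitangencyPointsOnLine F G h).Finite) := by
  have hpt : ∀ s, Mh h hh (pt s) ≠ 0 := by
    intro s h0
    rw [LinearEquiv.map_eq_zero_iff] at h0
    have := congrFun h0 0
    simp at this
  let g : ℂ → Projectivization ℂ (Fin 3 → ℂ) := fun s => Projectivization.mk ℂ _ (hpt s)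
  have hginj : Function.Injective g := by
    intro s s' hs
    obtain ⟨a, ha⟩ := (Projectivization.mk_eq_mk_iff' ℂ _ _ _ _).1 hs
    rw [← map_smul, (Mh h hh).injective.eq_iff] at ha
    have e0 := congrFun ha 0
    have e1 := congrFun ha 1
    simp at e0 e1
    rw [← e1, e0, one_mul]
  have himg : bitangencyPointsOnLine F G h = Set.image g {s : ℂ | Bit (subF h F) (subF h G) (pt s)} := by
    ext p
    have hmem : p ∈ bitangencyPointsOnLine F G h ↔ (∑ i, h i * p.rep i) = 0 ∧ Bit F G p.rep := by
      rw [Bit_iff_pencil]; rfl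
    rw [hmem]
    constructor
    · rintro ⟨h1, h2⟩
      obtain ⟨v, hv⟩ := (Mh h hh).surjective p.rep
      rw [← hv] at h1 h2
      have hv2 : v 2 = 0 := by
        have : h 2 * v 2 = 0 := by
          rw [← h1, Fin.sum_univ_three]
          simp [Mh]
          ring
        simpa [hh] using this
      rw [← Bit_subF] at h2
      by_cases hv0 : v 0 = 0
      · exfalso
        have hv1 : v = v 1 • pinf := by
          ext i
          fin_cases i <;> simp [hv0, hv2]
        have hne : v 1 ≠ 0 := by
          intro h0
          rw [h0, zero_smul] at hv1
          apply p.rep_nonzero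
          rw [← hv, hv1, map_zero]
        rw [hv1, Bit_smul_iff (subF_hom h hF) (subF_hom h hG) _ _ hne] at h2
        exact hinf h2
      · have hv1 : v = v 0 • pt (v 1 / v 0) := by
          ext i
          fin_cases i <;> simp [hv2]
          field_simp
        refine ⟨v 1 / v 0, ?_, ?_⟩
        · rw [hv1, Bit_smul_iff (subF_hom h hF) (subF_hom h hG) _ _ hv0] at h2
          exact h2
        · rw [← p.mk_rep]
          refine (Projectivization.mk_eq_mk_iff' ℂ _ _ _ _).2 ⟨(v 0)⁻¹, ?_⟩
          rw [← hv, ← map_smul]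
          congr 1
          conv_lhs => rw [hv1]
          rw [smul_smul]
          simp [hv0]
    · rintro ⟨s, hs, rfl⟩
      obtain ⟨a, ha⟩ := Projectivization.exists_smul_eq_mk_rep ℂ _ (hpt s)
      have ha' : (g s).rep = (a : ℂ) • Mh h hh (pt s) := ha.symm
      rw [ha']
      refine ⟨?_, ?_⟩
      · rw [Fin.sum_univ_three]
        simp [Mh]
        ring
      · rw [Bit_smul_iff hF hG _ _ a.ne_zero, ← Bit_subF]
        exact hs
  rw [himg]
  exact ⟨Set.ncard_image_of_injective _ hginj, fun hf => hf.image _⟩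

lemma subF_formOf (h : Fin 3 → ℂ) {d : ℕ} (b : Mon d → ℂ) :
    subF h (formOf b) = ∑ m : Mon d, MvPolynomial.C (b m) * ∏ i, subV h i ^ m.1 i := by
  unfold formOf subF
  rw [map_sum]
  refine Finset.sum_congr rfl fun m _ => ?_
  rw [MvPolynomial.aeval_monomial, Finsupp.prod_fintype _ _ (by simp)]
  rfl

lemma PM.subF {I : Type*} {h : Fin 3 → (I → ℂ) → ℂ} (hh : ∀ i, PF (h i)) {d : ℕ}
    {b : Mon d → (I → ℂ) → ℂ} (hb : ∀ m, PF (b m)) :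
    PM (fun x => _root_.subF (fun i => h i x) (_root_.formOf (fun m => b m x))) := by
  simp only [subF_formOf]
  refine PM.sum _ fun m _ => PM.mul (PM.C (hb m)) (PM.prod _ fun i _ => PM.pow ?_ _)
  fin_cases i
  · exact PM.mul (PM.C (hh 2)) (PM.X _)
  · exact PM.mul (PM.C (hh 2)) (PM.X _)
  · exact PM.add (PM.add (PM.mul (PM.C ((PF.const _).mul (hh 0))) (PM.X _))
      (PM.mul (PM.C ((PF.const _).mul (hh 1))) (PM.X _))) (PM.X _)

/-- coefficients of the transformed pencil -/
def xOf (k : ℕ) (z : ((Fin 3 →₀ ℕ) ⊕ (Fin 3 →₀ ℕ)) ⊕ Fin 3 → ℂ) (j : Jk k) : ℂ :=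
  Sum.elim
    (fun m => (subF (fun i => z (Sum.inr i))
      (formOf (fun m : Mon (k + 3) => z (Sum.inl (Sum.inl m.1))))).coeff m.1)
    (fun m => (subF (fun i => z (Sum.inr i))
      (formOf (fun m : Mon (k + 3) => z (Sum.inl (Sum.inr m.1))))).coeff m.1) j

lemma PF_xOf (k : ℕ) (j : Jk k) : PF (fun z => xOf k z j) := by
  unfold xOf
  rcases j with m | m
  · exact PM.coeff (PM.subF (fun i => PF.var _) fun m => PF.var _) _
  · exact PM.coeff (PM.subF (fun i => PF.var _) fun m => PF.var _) _

lemma xOf_inl (k : ℕ) (F G : Form) (h : Fin 3 → ℂ) (m : Mon (k + 3)) :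
    xOf k (Sum.elim (coeffs2 F G) h) (Sum.inl m) =
      (subF h (formOf (fun m : Mon (k + 3) => F.coeff m.1))).coeff m.1 := rfl

lemma FF_xOf (k : ℕ) {F G : Form} (hF : F.IsHomogeneous (k + 3)) (h : Fin 3 → ℂ) :
    FF (xOf k (Sum.elim (coeffs2 F G) h)) = subF h F := by
  have h1 : formOf (fun m : Mon (k + 3) => F.coeff m.1) = F := formOf_coeff hF
  have h2 : formOf (fun m : Mon (k + 3) => (subF h F).coeff m.1) = subF h F :=
    formOf_coeff (subF_hom h hF)
  refine Eq.trans ?_ h2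
  unfold FF
  refine congrArg formOf (funext fun m => ?_)
  rw [xOf_inl, h1]

lemma xOf_inr (k : ℕ) (F G : Form) (h : Fin 3 → ℂ) (m : Mon (k + 3)) :
    xOf k (Sum.elim (coeffs2 F G) h) (Sum.inr m) =
      (subF h (formOf (fun m : Mon (k + 3) => G.coeff m.1))).coeff m.1 := rfl

lemma GG_xOf (k : ℕ) {F G : Form} (hG : G.IsHomogeneous (k + 3)) (h : Fin 3 → ℂ) :
    GG (xOf k (Sum.elim (coeffs2 F G) h)) = subF h G := by
  have h1 : formOf (fun m : Mon (k + 3) => G.coeff m.1) = G := formOf_coeff hG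
  have h2 : formOf (fun m : Mon (k + 3) => (subF h G).coeff m.1) = subF h G :=
    formOf_coeff (subF_hom h hG)
  refine Eq.trans ?_ h2
  unfold GG
  refine congrArg formOf (funext fun m => ?_)
  rw [xOf_inr, h1]

lemma subF_id (F : Form) : subF ![0, 0, 1] F = F := by
  unfold subF
  have : subV ![0, 0, 1] = MvPolynomial.X := by
    ext1 i
    fin_cases i <;> simp [subV]
  rw [this]
  simp

lemma formOf_inj {d : ℕ} {b c : Mon d → ℂ} (h : formOf b = formOf c) : b = c := by
  ext m
  rw [← coeff_formOf b m, h, coeff_formOf]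

lemma final (k : ℕ) :
    ∃ Q : MvPolynomial (((Fin 3 →₀ ℕ) ⊕ (Fin 3 →₀ ℕ)) ⊕ Fin 3) ℂ,
      (∃ (F G : MvPolynomial (Fin 3) ℂ) (h : Fin 3 → ℂ),
          F.IsHomogeneous (k + 3) ∧ G.IsHomogeneous (k + 3) ∧ LinearIndependent ℂ ![F, G] ∧ h ≠ 0 ∧
          MvPolynomial.eval (Sum.elim (coeffs2 F G) h) Q ≠ 0) ∧
      ∀ (F G : MvPolynomial (Fin 3) ℂ) (h : Fin 3 → ℂ),
        F.IsHomogeneous (k + 3) → G.IsHomogeneous (k + 3) →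
        MvPolynomial.eval (Sum.elim (coeffs2 F G) h) Q ≠ 0 →
          (bitangencyPointsOnLine F G h).Finite ∧
            (bitangencyPointsOnLine F G h).ncard = k * (2 * k ^ 2 + 17 * k + 27) := by
  obtain ⟨Q0, hQ0, hcount⟩ := count_coord k
  have hPF : PF (fun z : ((Fin 3 →₀ ℕ) ⊕ (Fin 3 →₀ ℕ)) ⊕ Fin 3 → ℂ =>
      z (Sum.inr 2) * MvPolynomial.eval (fun j => xOf k z j) Q0) :=
    (PF.var _).mul (PF.comp ⟨Q0, fun x => rfl⟩ (PF_xOf k))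
  obtain ⟨Q, hQ⟩ := hPF
  refine ⟨Q, ?_, ?_⟩
  · obtain ⟨x, hx⟩ := exists_ne_zero_eval hQ0
    have e1 : FF (xOf k (Sum.elim (coeffs2 (FF x) (GG x)) ![0, 0, 1])) = FF x := by
      rw [FF_xOf k (formOf_hom _), subF_id]
    have e2 : GG (xOf k (Sum.elim (coeffs2 (FF x) (GG x)) ![0, 0, 1])) = GG x := by
      rw [GG_xOf k (formOf_hom _), subF_id]
    have e3 : (fun j => xOf k (Sum.elim (coeffs2 (FF x) (GG x)) ![0, 0, 1]) j) = x := by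
      ext j
      rcases j with m | m
      · exact congrFun (formOf_inj e1) m
      · exact congrFun (formOf_inj e2) m
    refine ⟨FF x, GG x, ![0, 0, 1], formOf_hom _, formOf_hom _, ?_, ?_, ?_⟩
    · have hW := (hcount x hx).2.2.2
      unfold Wv at hW
      rw [crossProduct_ne_zero_iff_linearIndependent, LinearIndependent.pair_iff] at hW
      rw [LinearIndependent.pair_iff]
      intro a b hab
      apply hW
      rw [← gr_smul, ← gr_smul, ← gr_add, hab]
      ext i
      simp [gr]
    · intro h0
      have := congrFun h0 2
      simp at this
    · rw [← hQ]
      beta_reduce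
      rw [e3]
      simpa using hx
  · intro F G h hF hG hne
    rw [← hQ] at hne
    have hh : h 2 ≠ 0 := left_ne_zero_of_mul hne
    have hx := right_ne_zero_of_mul hne
    have := hcount _ hx
    have e1 : FF (fun j => xOf k (Sum.elim (coeffs2 F G) h) j) = subF h F := FF_xOf k hF h
    have e2 : GG (fun j => xOf k (Sum.elim (coeffs2 F G) h) j) = subF h G := GG_xOf k hG h
    rw [e1, e2] at this
    obtain ⟨h1, h2, h3, _⟩ := this
    obtain ⟨h4, h5⟩ := set_eq hF hG h hh h1
    exact ⟨h5 h2, h4.trans h3⟩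

end

/-- For a general pencil of degree-`d` plane curves and a general line
`H = {h·y = 0} ⊂ ℙ²`, the number of points `p ∈ H` which are tangency points of a
bitangent line of some member of the pencil is exactly `(d − 3)(2d² + 5d − 6)`. -/
theorem bitangency_points_on_general_line_count (d : ℕ) (hd : 3 ≤ d) :
    ∃ Q : MvPolynomial (((Fin 3 →₀ ℕ) ⊕ (Fin 3 →₀ ℕ)) ⊕ Fin 3) ℂ,
      (∃ (F G : MvPolynomial (Fin 3) ℂ) (h : Fin 3 → ℂ),
          F.IsHomogeneous d ∧ G.IsHomogeneous d ∧ LinearIndependent ℂ ![F, G] ∧ h ≠ 0 ∧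
          MvPolynomial.eval (Sum.elim (coeffs2 F G) h) Q ≠ 0) ∧
      ∀ (F G : MvPolynomial (Fin 3) ℂ) (h : Fin 3 → ℂ),
        F.IsHomogeneous d → G.IsHomogeneous d → LinearIndependent ℂ ![F, G] → h ≠ 0 →
        MvPolynomial.eval (Sum.elim (coeffs2 F G) h) Q ≠ 0 →
          (bitangencyPointsOnLine F G h).Finite ∧
            ((bitangencyPointsOnLine F G h).ncard : ℤ) =
              ((d : ℤ) - 3) * (2 * (d : ℤ) ^ 2 + 5 * (d : ℤ) - 6) := by
  obtain ⟨k, rfl⟩ : ∃ k, d = k + 3 := ⟨d - 3, by omega⟩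
  obtain ⟨Q, hw, hQ⟩ := final k
  refine ⟨Q, hw, fun F G h hF hG _ _ hne => ?_⟩
  obtain ⟨h1, h2⟩ := hQ F G h hF hG hne
  refine ⟨h1, ?_⟩
  rw [h2]
  push_cast
  ring
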